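/- arXiv:2202.07696 — 2 statements merged into one kernel-verified Lean document; each statement's English description precedes it below -/
import Mathlib

section
/- Let K be a field, R = K[x_1,...,x_n], d a positive integer, α: R → R the K-algebra map with α(x_i) = x_i^d, and I a homogeneous ideal of R with I' = α(I)R. Then the graded Betti numbers satisfy β_{i,jd}(I') = β_{i,j}(I) for all i, j, and β_{i,j}(I') = 0 whenever d does not divide j. -/
open MvPolynomial

variable {K : Type} [Field K]

/-- The degree-`k` homogeneous component of a homogeneous ideal `I`,
as a `K`-vector subspace of the polynomial ring (zero in negative degrees). -/
noncomputable def idealPiece {n : ℕ} (I : Ideal (MvPolynomial (Fin n) K)) (k : ℤ) :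
    Submodule K (MvPolynomial (Fin n) K) :=
  if 0 ≤ k then
    (Submodule.restrictScalars K (I : Submodule (MvPolynomial (Fin n) K) (MvPolynomial (Fin n) K)))
      ⊓ (homogeneousSubmodule (Fin n) K k.toNat)
  else ⊥

lemma mul_X_mem_idealPiece {n : ℕ} (I : Ideal (MvPolynomial (Fin n) K)) (t : Fin n) (k : ℤ)
    {x : MvPolynomial (Fin n) K} (hx : x ∈ idealPiece I k) :
    (X t : MvPolynomial (Fin n) K) * x ∈ idealPiece I (k + 1) := by
  by_cases h : 0 ≤ k
  · rw [idealPiece, if_pos h] at hx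
    rw [idealPiece, if_pos (by omega)]
    refine ⟨I.mul_mem_left _ hx.1, ?_⟩
    rw [Submodule.mem_inf] at hx
    have hh : x.IsHomogeneous k.toNat := (mem_homogeneousSubmodule _ _).1 hx.2
    have : ((X t : MvPolynomial (Fin n) K) * x).IsHomogeneous (1 + k.toNat) :=
      (isHomogeneous_X K t).mul hh
    have he : (k + 1).toNat = 1 + k.toNat := by omega
    exact (mem_homogeneousSubmodule _ _).2 (he ▸ this)
  · rw [idealPiece, if_neg h, Submodule.mem_bot] at hx
    rw [hx, mul_zero]
    exact Submodule.zero_mem _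

/-- Multiplication by the variable `X t` as a linear map between graded pieces. -/
noncomputable def mulXPiece {n : ℕ} (I : Ideal (MvPolynomial (Fin n) K)) (t : Fin n) (k : ℤ) :
    idealPiece I k →ₗ[K] idealPiece I (k + 1) :=
  (LinearMap.mulLeft K (X t)).restrict (fun _ hx => mul_X_mem_idealPiece I t k hx)

/-- Index set of the `i`-th term of the Koszul complex: subsets of the variables of size `i`. -/
abbrev KoszulIdx (n i : ℕ) := {s : Finset (Fin n) // s.card = i}

/-- The Koszul differential (in internal degree `j`) of the complex computing
`Tor(I, K)`, from homological degree `i+1` to homological degree `i`. -/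
noncomputable def koszulDiff {n : ℕ} (I : Ideal (MvPolynomial (Fin n) K)) (i : ℕ) (j : ℤ) :
    ((KoszulIdx n (i + 1)) → idealPiece I (j - (i + 1 : ℕ)))
      →ₗ[K] ((KoszulIdx n i) → idealPiece I (j - (i : ℕ))) :=
  ∑ s' : KoszulIdx n (i + 1), ∑ t ∈ (s' : Finset (Fin n)).attach,
    ((-1 : K) ^ (((s' : Finset (Fin n)).filter (fun u => u < t.1)).card)) •
      ((LinearMap.single (R := K) (φ := fun _ : KoszulIdx n i => idealPiece I (j - (i : ℕ)))
          ⟨(s' : Finset (Fin n)).erase t.1, by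
            rw [Finset.card_erase_of_mem t.2, s'.2]; rfl⟩) ∘ₗ
        (LinearEquiv.ofEq _ _ (by rw [show j - ((i : ℕ) + 1 : ℕ) + 1 = j - (i : ℕ) by push_cast; ring])).toLinearMap ∘ₗ
        (mulXPiece I t.1 (j - ((i : ℕ) + 1 : ℕ))) ∘ₗ
        (LinearMap.proj s'))

/-- Cycles of the Koszul complex at homological degree `i`, internal degree `j`. -/
noncomputable def koszulCycles {n : ℕ} (I : Ideal (MvPolynomial (Fin n) K)) :
    (i : ℕ) → (j : ℤ) → Submodule K ((KoszulIdx n i) → idealPiece I (j - (i : ℕ)))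
  | 0, _ => ⊤
  | (i + 1), j => LinearMap.ker (koszulDiff I i j)

set_option synthInstance.maxHeartbeats 1000000 in
set_option maxHeartbeats 1000000 in
/-- The graded Betti number `β_{i,j}(I) = dim_K Tor_i(I, K)_j`, computed as the dimension
of the homology of the Koszul complex (all spaces involved are finite-dimensional, so the
dimension of the homology `Z/B` is `dim Z - dim (B ⊓ Z)`). -/
noncomputable def gradedBetti {n : ℕ} (I : Ideal (MvPolynomial (Fin n) K)) (i : ℕ) (j : ℤ) : ℕ :=
  Module.finrank K ↥(koszulCycles I i j) -
    Module.finrank K ↥(LinearMap.range (koszulDiff I i j) ⊓ koszulCycles I i j)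

/-- The Castelnuovo–Mumford regularity `reg(I) = max { j - i : β_{i,j}(I) ≠ 0 }`. -/
noncomputable def reg {n : ℕ} (I : Ideal (MvPolynomial (Fin n) K)) : ℤ :=
  sSup {r : ℤ | ∃ (i : ℕ) (j : ℤ), gradedBetti I i j ≠ 0 ∧ r = j - i}

/-- `t_i(I) = max { j : β_{i,j}(I) ≠ 0 }`, the maximal shift in homological degree `i`. -/
noncomputable def maxShift {n : ℕ} (I : Ideal (MvPolynomial (Fin n) K)) (i : ℕ) : ℤ :=
  sSup {j : ℤ | gradedBetti I i j ≠ 0}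

/-- The projective dimension of `I`. -/
noncomputable def projdim {n : ℕ} (I : Ideal (MvPolynomial (Fin n) K)) : ℕ :=
  sSup {i : ℕ | ∃ j : ℤ, gradedBetti I i j ≠ 0}

/-- An ideal of a polynomial ring is homogeneous (for the standard grading) if it contains
all homogeneous components of its elements. -/
def IsHomogeneousIdeal {n : ℕ} (I : Ideal (MvPolynomial (Fin n) K)) : Prop :=
  ∀ f ∈ I, ∀ k : ℕ, homogeneousComponent k f ∈ I

section KoszulPowerMap

variable {n : ℕ}

open Classical in
/-- The polynomial whose coefficient at `m` is the coefficient of `g` at `e m` if `p m` holds,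
and zero otherwise. -/
noncomputable def selectCoeff (e : (Fin n →₀ ℕ) → (Fin n →₀ ℕ)) (he : Function.Injective e)
    (p : (Fin n →₀ ℕ) → Prop) :
    MvPolynomial (Fin n) K →ₗ[K] MvPolynomial (Fin n) K :=
  have key : ∀ (g : MvPolynomial (Fin n) K) (m : Fin n →₀ ℕ),
      coeff m (∑ m' ∈ g.support.preimage e he.injOn,
        monomial m' (if p m' then coeff (e m') g else 0)) = if p m then coeff (e m) g else 0 := by
    intro g m
    simp only [coeff_sum, coeff_monomial, Finset.sum_ite_eq', Finset.mem_preimage, mem_support_iff]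
    split_ifs <;> simp_all
  { toFun := fun g => ∑ m' ∈ g.support.preimage e he.injOn,
      monomial m' (if p m' then coeff (e m') g else 0)
    map_add' := by
      intro f g
      ext m
      rw [coeff_add, key, key, key]
      split_ifs <;> simp
    map_smul' := by
      intro c f
      ext m
      rw [RingHom.id_apply, coeff_smul, key, key]
      split_ifs <;> simp }

open Classical in
lemma coeff_selectCoeff (e : (Fin n →₀ ℕ) → (Fin n →₀ ℕ)) (he : Function.Injective e)
    (p : (Fin n →₀ ℕ) → Prop) (g : MvPolynomial (Fin n) K) (m : Fin n →₀ ℕ) :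
    coeff m (selectCoeff e he p g) = if p m then coeff (e m) g else 0 := by
  change coeff m (∑ m' ∈ g.support.preimage e he.injOn,
    monomial m' (if p m' then coeff (e m') g else 0)) = _
  simp only [coeff_sum, coeff_monomial, Finset.sum_ite_eq', Finset.mem_preimage, mem_support_iff]
  split_ifs <;> simp_all

lemma mem_idealPiece_iff (I : Ideal (MvPolynomial (Fin n) K)) (k : ℤ)
    (f : MvPolynomial (Fin n) K) :
    f ∈ idealPiece I k ↔ f ∈ I ∧ ∀ m, coeff m f ≠ 0 → (m.degree : ℤ) = k := by
  unfold idealPiece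
  split_ifs with h
  · rw [Submodule.mem_inf, Submodule.restrictScalars_mem, mem_homogeneousSubmodule]
    refine and_congr_right fun _ => ⟨fun hf m hm => ?_, fun hf m hm => ?_⟩
    · have : m.degree = k.toNat := by
        by_contra hne
        exact hm (hf.coeff_eq_zero hne)
      omega
    · have h1 := hf m hm
      have h2 : Finsupp.weight (1 : Fin n → ℕ) m = m.degree := by
        rw [Finsupp.degree_eq_weight_one]
        rfl
      omega
  · rw [Submodule.mem_bot]
    refine ⟨fun hf => by simp [hf], fun hf => ?_⟩
    ext m
    by_contra hne
    have := hf.2 m (by simpa using hne)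
    omega

instance finite_idealPiece (I : Ideal (MvPolynomial (Fin n) K)) (k : ℤ) :
    Module.Finite K (idealPiece I k) := by
  by_cases h : 0 ≤ k
  · have : Module.Finite K (homogeneousSubmodule (Fin n) K k.toNat) :=
      Module.Finite.iff_fg.mpr (homogeneousSubmodule_fg _ _ _)
    rw [idealPiece, if_pos h]
    exact Submodule.finiteDimensional_inf_right _ _
  · rw [idealPiece, if_neg h]
    infer_instance

/-- The sign of the wedge product of `e_t` with `e_s`. -/
def koszulSign (K : Type) [Field K] (s : Finset (Fin n)) (t : Fin n) : K :=
  (-1) ^ (s.filter (fun u => u < t)).card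

lemma koszulSign_mul_self (s : Finset (Fin n)) (t : Fin n) :
    koszulSign K s t * koszulSign K s t = 1 := by
  rw [koszulSign, ← pow_add, ← two_mul, pow_mul]
  simp

lemma koszulSign_insert {s : Finset (Fin n)} {t : Fin n} (ht : t ∉ s) (u : Fin n) :
    koszulSign K (insert t s) u = (if t < u then -1 else 1) * koszulSign K s u := by
  rw [koszulSign, koszulSign, Finset.filter_insert]
  split_ifs
  · rw [Finset.card_insert_of_notMem (by simp [ht]), pow_succ, mul_comm]
  · rw [one_mul]

lemma koszulSign_erase_self (s : Finset (Fin n)) (t : Fin n) :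
    koszulSign K (s.erase t) t = koszulSign K s t := by
  rw [koszulSign, koszulSign]
  congr 2
  ext u
  simp only [Finset.mem_filter, Finset.mem_erase]
  grind

lemma koszulSign_swap {s : Finset (Fin n)} {t u : Fin n} (ht : t ∉ s) (hu : u ∈ s) :
    koszulSign K s t * koszulSign K ((insert t s).erase u) u =
      -(koszulSign K (s.erase u) u * koszulSign K (s.erase u) t) := by
  have hne : t ≠ u := by rintro rfl; exact ht hu
  have h1 : koszulSign K s t = (if u < t then -1 else 1) * koszulSign K (s.erase u) t := by
    conv_lhs => rw [← Finset.insert_erase hu]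
    exact koszulSign_insert (by simp) t
  have h2 : (insert t s).erase u = insert t (s.erase u) := by
    ext v
    simp only [Finset.mem_erase, Finset.mem_insert]
    grind
  rw [h1, h2, koszulSign_insert (by simp [ht])]
  rcases lt_or_gt_of_ne hne with h | h
  · rw [if_neg h.not_gt, if_pos h]; ring
  · rw [if_pos h, if_neg h.not_gt]; ring

/-- The differential of the Koszul complex of the variables on the polynomial ring, without
any restriction on degrees. -/
noncomputable def totalDiff :
    (Finset (Fin n) → MvPolynomial (Fin n) K) →ₗ[K] (Finset (Fin n) → MvPolynomial (Fin n) K) :=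
  LinearMap.pi fun s => ∑ t : Fin n, if t ∈ s then 0 else
    koszulSign K s t • (LinearMap.mulLeft K (X t) ∘ₗ LinearMap.proj (insert t s))

lemma totalDiff_apply (U : Finset (Fin n) → MvPolynomial (Fin n) K) (s : Finset (Fin n)) :
    totalDiff U s = ∑ t : Fin n, if t ∈ s then 0 else
      koszulSign K s t • (X t * U (insert t s)) := by
  simp only [totalDiff, LinearMap.pi_apply, LinearMap.sum_apply]
  refine Finset.sum_congr rfl fun t _ => ?_
  split_ifs <;> simp

/-- The exponent vector of the squarefree monomial with support `s`. -/
noncomputable def indicatorExp (s : Finset (Fin n)) : Fin n →₀ ℕ :=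
  Finsupp.equivFunOnFinite.symm fun u => if u ∈ s then 1 else 0

lemma indicatorExp_apply (s : Finset (Fin n)) (u : Fin n) :
    indicatorExp s u = if u ∈ s then 1 else 0 := rfl

lemma degree_indicatorExp (s : Finset (Fin n)) : (indicatorExp s).degree = s.card := by
  simp [Finsupp.degree_eq_sum, indicatorExp_apply]

/-- `t` is the first coordinate of `c` not divisible by `d`. -/
def IsFirstNotDvd (d : ℕ) (c : Fin n →₀ ℕ) (t : Fin n) : Prop :=
  ¬ d ∣ c t ∧ ∀ u < t, d ∣ c u

lemma IsFirstNotDvd.unique {d : ℕ} {c : Fin n →₀ ℕ} {t u : Fin n} (ht : IsFirstNotDvd d c t)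
    (hu : IsFirstNotDvd d c u) : t = u := by
  rcases lt_trichotomy t u with h | h | h
  · exact absurd (hu.2 t h) ht.1
  · exact h
  · exact absurd (ht.2 u h) hu.1

lemma forall_dvd_or_exists_isFirstNotDvd (d : ℕ) (c : Fin n →₀ ℕ) :
    (∀ u, d ∣ c u) ∨ ∃ t, IsFirstNotDvd d c t := by
  by_cases h : ∀ u, d ∣ c u
  · exact Or.inl h
  · push Not at h
    obtain ⟨t, ht, hmin⟩ := WellFounded.has_min (wellFounded_lt (α := Fin n)) {u | ¬ d ∣ c u} h
    refine Or.inr ⟨t, ht, fun u hu => ?_⟩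
    by_contra hne
    exact hmin u hne hu

/-- Division by `X t` of the part of a polynomial for which `t` is the first coordinate of the
multidegree, shifted by `s`, that is not divisible by `d`. -/
noncomputable def divFirst (d : ℕ) (s : Finset (Fin n)) (t : Fin n) :
    MvPolynomial (Fin n) K →ₗ[K] MvPolynomial (Fin n) K :=
  selectCoeff (fun m => m + Finsupp.single t 1) (add_left_injective _)
    (fun m => IsFirstNotDvd d (m + indicatorExp s) t)

/-- The homotopy contracting the summands of the Koszul complex in multidegrees not divisible
by `d`. -/
noncomputable def totalHomotopy (d : ℕ) :
    (Finset (Fin n) → MvPolynomial (Fin n) K) →ₗ[K] (Finset (Fin n) → MvPolynomial (Fin n) K) :=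
  LinearMap.pi fun s => ∑ t : Fin n, if t ∈ s then
    koszulSign K (s.erase t) t • (divFirst d s t ∘ₗ LinearMap.proj (s.erase t)) else 0

lemma totalHomotopy_apply (d : ℕ) (U : Finset (Fin n) → MvPolynomial (Fin n) K)
    (s : Finset (Fin n)) :
    totalHomotopy d U s = ∑ t : Fin n, if t ∈ s then
      koszulSign K (s.erase t) t • divFirst d s t (U (s.erase t)) else 0 := by
  simp only [totalHomotopy, LinearMap.pi_apply, LinearMap.sum_apply]
  refine Finset.sum_congr rfl fun t _ => ?_
  split_ifs <;> simp

lemma coeff_totalDiff (U : Finset (Fin n) → MvPolynomial (Fin n) K) (s : Finset (Fin n))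
    (m : Fin n →₀ ℕ) :
    coeff m (totalDiff U s) = ∑ t : Fin n, if t ∉ s ∧ m t ≠ 0 then
      koszulSign K s t * coeff (m - Finsupp.single t 1) (U (insert t s)) else 0 := by
  rw [totalDiff_apply, coeff_sum]
  refine Finset.sum_congr rfl fun t _ => ?_
  by_cases ht : t ∈ s
  · simp [ht]
  · by_cases hm : m t = 0 <;> simp [ht, hm, coeff_X_mul']

lemma coeff_totalHomotopy_of_dvd {d : ℕ} (U : Finset (Fin n) → MvPolynomial (Fin n) K)
    {s : Finset (Fin n)} {m : Fin n →₀ ℕ} (h : ∀ u, d ∣ (m + indicatorExp s) u) :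
    coeff m (totalHomotopy d U s) = 0 := by
  rw [totalHomotopy_apply, coeff_sum]
  refine Finset.sum_eq_zero fun t _ => ?_
  split_ifs
  · rw [coeff_smul, divFirst, coeff_selectCoeff, if_neg (fun h' => h'.1 (h t)), smul_zero]
  · simp

lemma coeff_totalHomotopy {d : ℕ} (U : Finset (Fin n) → MvPolynomial (Fin n) K)
    {s : Finset (Fin n)} {m : Fin n →₀ ℕ} {t : Fin n}
    (h : IsFirstNotDvd d (m + indicatorExp s) t) :
    coeff m (totalHomotopy d U s) = if t ∈ s then koszulSign K (s.erase t) t *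
      coeff (m + Finsupp.single t 1) (U (s.erase t)) else 0 := by
  rw [totalHomotopy_apply, coeff_sum, Finset.sum_eq_single t]
  · split_ifs
    · rw [coeff_smul, divFirst, coeff_selectCoeff, if_pos h, smul_eq_mul]
    · simp
  · intro u _ hu
    split_ifs
    · rw [coeff_smul, divFirst, coeff_selectCoeff, if_neg (fun h' => hu (h'.unique h)), smul_zero]
    · simp
  · simp

lemma sub_single_add_indicatorExp_insert {s : Finset (Fin n)} {m : Fin n →₀ ℕ} {t : Fin n}
    (ht : t ∉ s) (hm : m t ≠ 0) :
    m - Finsupp.single t 1 + indicatorExp (insert t s) = m + indicatorExp s := by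
  ext u
  simp only [Finsupp.add_apply, Finsupp.tsub_apply, indicatorExp_apply, Finset.mem_insert,
    Finsupp.single_apply]
  by_cases hu : u = t
  · subst hu
    simp only [if_true, true_or, if_neg ht]
    omega
  · simp [hu, Ne.symm hu]

lemma coeff_diff_homotopy_of_dvd {d : ℕ} (U : Finset (Fin n) → MvPolynomial (Fin n) K)
    {s : Finset (Fin n)} {m : Fin n →₀ ℕ} (h : ∀ u, d ∣ (m + indicatorExp s) u) :
    coeff m (totalDiff (totalHomotopy d U) s + totalHomotopy d (totalDiff U) s) = 0 := by
  rw [coeff_add, coeff_totalHomotopy_of_dvd _ h, add_zero, coeff_totalDiff]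
  refine Finset.sum_eq_zero fun t _ => ?_
  split_ifs with ht
  · rw [coeff_totalHomotopy_of_dvd, mul_zero]
    rwa [sub_single_add_indicatorExp_insert ht.1 ht.2]
  · rfl

lemma coeff_diff_homotopy_of_not_dvd {d : ℕ} (U : Finset (Fin n) → MvPolynomial (Fin n) K)
    {s : Finset (Fin n)} {m : Fin n →₀ ℕ} (h : ¬ ∀ u, d ∣ (m + indicatorExp s) u) :
    coeff m (totalDiff (totalHomotopy d U) s + totalHomotopy d (totalDiff U) s) =
      coeff m (U s) := by
  obtain ⟨t₀, ht₀⟩ := (forall_dvd_or_exists_isFirstNotDvd d (m + indicatorExp s)).resolve_left h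
  have hD : coeff m (totalDiff (totalHomotopy d U) s) = ∑ t : Fin n, if t ∉ s ∧ m t ≠ 0 then
      koszulSign K s t * (if t₀ ∈ insert t s then koszulSign K ((insert t s).erase t₀) t₀ *
        coeff (m - Finsupp.single t 1 + Finsupp.single t₀ 1) (U ((insert t s).erase t₀)) else 0)
      else 0 := by
    rw [coeff_totalDiff]
    refine Finset.sum_congr rfl fun t _ => ?_
    split_ifs with ht h'
    · rw [coeff_totalHomotopy (t := t₀), if_pos h']
      rwa [sub_single_add_indicatorExp_insert ht.1 ht.2]
    · rw [coeff_totalHomotopy (t := t₀), if_neg h']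
      rwa [sub_single_add_indicatorExp_insert ht.1 ht.2]
    · rfl
  rw [coeff_add, hD, coeff_totalHomotopy _ ht₀]
  by_cases hs : t₀ ∈ s
  · rw [if_pos hs, coeff_totalDiff, Finset.mul_sum, ← Finset.sum_add_distrib,
      Finset.sum_eq_single t₀]
    · simp only [hs, not_true_eq_false, false_and, if_false, zero_add]
      rw [if_pos (by simp), Finset.insert_erase hs, ← mul_assoc, koszulSign_mul_self, one_mul,
        add_tsub_cancel_right]
    · intro t _ ht
      by_cases hts : t ∈ s
      · simp [hts, ht]
      · by_cases hm : m t = 0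
        · simp [hm, Ne.symm ht]
        · rw [if_pos ⟨hts, hm⟩, if_pos (by simp [hs]), if_pos (by simp [hts, hm]), ← mul_assoc,
            koszulSign_swap hts hs, ← mul_assoc]
          have h1 : m - Finsupp.single t 1 + Finsupp.single t₀ 1 =
              m + Finsupp.single t₀ 1 - Finsupp.single t 1 := by
            ext u
            simp only [Finsupp.add_apply, Finsupp.tsub_apply, Finsupp.single_apply]
            split_ifs with h1 h2
            · exact absurd (h1.trans h2.symm) ht
            all_goals subst_vars; omega
          have h2 : (insert t s).erase t₀ = insert t (s.erase t₀) := by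
            ext v
            simp only [Finset.mem_erase, Finset.mem_insert]
            grind
          rw [h1, h2]
          ring
    · simp
  · have hm : m t₀ ≠ 0 := by
      intro h0
      apply ht₀.1
      simp [h0, indicatorExp_apply, hs]
    rw [if_neg hs, add_zero, Finset.sum_eq_single t₀]
    · rw [if_pos ⟨hs, hm⟩, if_pos (by simp), Finset.erase_insert hs, ← mul_assoc,
        koszulSign_mul_self, one_mul, tsub_add_cancel_of_le]
      simpa [Finsupp.single_le_iff] using Nat.one_le_iff_ne_zero.mpr hm
    · intro t _ ht
      simp [hs, Ne.symm ht]
    · simp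

lemma smul_add_left_injective {d : ℕ} (hd : 0 < d) (a : Fin n →₀ ℕ) :
    Function.Injective fun m : Fin n →₀ ℕ => d • m + a := fun m m' h => by
  ext u
  have := DFunLike.congr_fun h u
  simpa [hd.ne'] using this

/-- The polynomial `f` such that `x ^ ((d - 1) • indicatorExp s) * expand d f` is the part of `g`
with exponents congruent to `(d - 1) • indicatorExp s` modulo `d`. -/
noncomputable def extract {d : ℕ} (hd : 0 < d) (s : Finset (Fin n)) :
    MvPolynomial (Fin n) K →ₗ[K] MvPolynomial (Fin n) K :=
  selectCoeff (fun m => d • m + (d - 1) • indicatorExp s) (smul_add_left_injective hd _)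
    (fun _ => True)

lemma coeff_extract {d : ℕ} (hd : 0 < d) (s : Finset (Fin n)) (g : MvPolynomial (Fin n) K)
    (m : Fin n →₀ ℕ) :
    coeff m (extract hd s g) = coeff (d • m + (d - 1) • indicatorExp s) g := by
  rw [extract, coeff_selectCoeff, if_pos trivial]

lemma extract_expand_mul {d : ℕ} (hd : 0 < d) (s : Finset (Fin n))
    (f g : MvPolynomial (Fin n) K) :
    extract hd s (expand d f * g) = f * extract hd s g := by
  induction f using induction_on' with
  | add p q hp hq => rw [map_add, add_mul, map_add, hp, hq, add_mul]
  | monomial p c =>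
    ext m
    rw [coeff_extract, expand_monomial, coeff_monomial_mul', coeff_monomial_mul', coeff_extract]
    have hle : d • p ≤ d • m + (d - 1) • indicatorExp s ↔ p ≤ m := by
      refine ⟨fun h u => ?_, fun h u => ?_⟩
      · have := h u
        simp only [Finsupp.smul_apply, Finsupp.add_apply, smul_eq_mul, indicatorExp_apply] at this
        by_contra hlt
        have h1 : d * (m u + 1) ≤ d * p u := Nat.mul_le_mul_left _ (by omega)
        rw [mul_add] at h1
        split_ifs at this <;> omega
      · have := Nat.mul_le_mul_left d (h u)
        simp only [Finsupp.smul_apply, Finsupp.add_apply, smul_eq_mul]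
        omega
    by_cases h : p ≤ m
    · rw [if_pos (hle.mpr h), if_pos h]
      congr 2
      ext u
      have := Nat.mul_le_mul_left d (h u)
      simp only [Finsupp.smul_apply, Finsupp.add_apply, Finsupp.tsub_apply, smul_eq_mul,
        Nat.mul_sub]
      omega
    · rw [if_neg (mt hle.mp h), if_neg h]

lemma divFirst_expand_mul {d : ℕ} {s : Finset (Fin n)} {t : Fin n} (ht : t ∈ s)
    (f g : MvPolynomial (Fin n) K) :
    divFirst d s t (expand d f * g) = expand d f * divFirst d s t g := by
  classical
  induction f using induction_on' with
  | add p q hp hq => rw [map_add, add_mul, map_add, hp, hq, add_mul]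
  | monomial p c =>
    ext m
    rw [divFirst, coeff_selectCoeff, expand_monomial, coeff_monomial_mul', coeff_monomial_mul',
      coeff_selectCoeff]
    by_cases h : d • p ≤ m
    · obtain ⟨q, rfl⟩ := exists_add_of_le h
      have hfirst : IsFirstNotDvd d (d • p + q + indicatorExp s) t ↔
          IsFirstNotDvd d (q + indicatorExp s) t := by
        have key : ∀ u, d ∣ (d • p + q + indicatorExp s) u ↔ d ∣ (q + indicatorExp s) u := by
          intro u
          rw [add_assoc, Finsupp.add_apply]
          exact (Nat.dvd_add_iff_right (by simp)).symm
        simp only [IsFirstNotDvd, key]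
      rw [if_pos h, if_pos (h.trans le_self_add), add_tsub_cancel_left,
        add_assoc (d • p) q (Finsupp.single t 1), add_tsub_cancel_left]
      simp only [hfirst, mul_ite, mul_zero]
    · rw [if_neg h]
      split_ifs with h1 h2
      · refine absurd (fun u => ?_) h
        have hu := h2 u
        have hdvd := h1.1
        simp only [Finsupp.add_apply, Finsupp.smul_apply, smul_eq_mul, indicatorExp_apply, if_pos ht,
          Finsupp.single_apply] at hu hdvd ⊢
        split_ifs at hu with hut
        · subst hut
          have : d * p t ≠ m t + 1 := fun h' => hdvd ⟨_, h'.symm⟩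
          omega
        · exact hu
      · rfl
      · rfl

/-- The embedding of the Koszul complex of an ideal into that of its extension along
`X t ↦ X t ^ d`. -/
noncomputable def totalExpand (d : ℕ) :
    (Finset (Fin n) → MvPolynomial (Fin n) K) →ₗ[K] (Finset (Fin n) → MvPolynomial (Fin n) K) :=
  LinearMap.pi fun s => LinearMap.mulLeft K (monomial ((d - 1) • indicatorExp s) 1) ∘ₗ
    (expand d).toLinearMap ∘ₗ LinearMap.proj s

lemma totalExpand_apply (d : ℕ) (U : Finset (Fin n) → MvPolynomial (Fin n) K)
    (s : Finset (Fin n)) :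
    totalExpand d U s = monomial ((d - 1) • indicatorExp s) 1 * expand d (U s) := rfl

/-- The retraction of `totalExpand`. -/
noncomputable def totalExtract {d : ℕ} (hd : 0 < d) :
    (Finset (Fin n) → MvPolynomial (Fin n) K) →ₗ[K] (Finset (Fin n) → MvPolynomial (Fin n) K) :=
  LinearMap.pi fun s => extract hd s ∘ₗ LinearMap.proj s

lemma totalExtract_apply {d : ℕ} (hd : 0 < d) (U : Finset (Fin n) → MvPolynomial (Fin n) K)
    (s : Finset (Fin n)) : totalExtract hd U s = extract hd s (U s) := rfl

lemma exists_eq_smul_add_indicatorExp {d : ℕ} (hd : 0 < d) {s : Finset (Fin n)}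
    {m : Fin n →₀ ℕ} (h : ∀ u, d ∣ (m + indicatorExp s) u) :
    ∃ q : Fin n →₀ ℕ, m = d • q + (d - 1) • indicatorExp s := by
  refine ⟨Finsupp.equivFunOnFinite.symm fun u =>
    (m + indicatorExp s) u / d - indicatorExp s u, ?_⟩
  ext u
  obtain ⟨c, hc⟩ := h u
  simp only [Finsupp.add_apply, Finsupp.smul_apply, smul_eq_mul,
    Finsupp.equivFunOnFinite_symm_apply_apply] at hc ⊢
  rw [hc, Nat.mul_div_cancel_left _ hd]
  simp only [indicatorExp_apply] at hc ⊢
  split_ifs at hc ⊢ with hu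
  · have hc0 : c ≠ 0 := by rintro rfl; simp at hc
    obtain ⟨b, rfl⟩ := Nat.exists_eq_succ_of_ne_zero hc0
    simp only [Nat.succ_eq_add_one, mul_add, mul_one, Nat.add_sub_cancel] at hc ⊢
    omega
  · simpa using hc

lemma coeff_totalExpand {d : ℕ} (hd : 0 < d) (U : Finset (Fin n) → MvPolynomial (Fin n) K)
    (s : Finset (Fin n)) (q : Fin n →₀ ℕ) :
    coeff (d • q + (d - 1) • indicatorExp s) (totalExpand d U s) = coeff q (U s) := by
  rw [totalExpand_apply, coeff_monomial_mul', if_pos (by simp), add_tsub_cancel_right,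
    coeff_expand_smul _ hd.ne', one_mul]

lemma totalExtract_totalExpand {d : ℕ} (hd : 0 < d)
    (U : Finset (Fin n) → MvPolynomial (Fin n) K) :
    totalExtract hd (totalExpand d U) = U := by
  ext s m
  rw [totalExtract_apply, coeff_extract, coeff_totalExpand hd]

lemma coeff_totalExpand_totalExtract {d : ℕ} (hd : 0 < d)
    (U : Finset (Fin n) → MvPolynomial (Fin n) K) {s : Finset (Fin n)} {m : Fin n →₀ ℕ}
    (h : ∀ u, d ∣ (m + indicatorExp s) u) :
    coeff m (totalExpand d (totalExtract hd U) s) = coeff m (U s) := by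
  obtain ⟨q, rfl⟩ := exists_eq_smul_add_indicatorExp hd h
  rw [coeff_totalExpand hd, totalExtract_apply, coeff_extract]

lemma coeff_totalExpand_of_not_dvd {d : ℕ} (hd : 0 < d)
    (U : Finset (Fin n) → MvPolynomial (Fin n) K) {s : Finset (Fin n)} {m : Fin n →₀ ℕ}
    (h : ¬ ∀ u, d ∣ (m + indicatorExp s) u) :
    coeff m (totalExpand d U s) = 0 := by
  push Not at h
  obtain ⟨u, hu⟩ := h
  rw [totalExpand_apply, coeff_monomial_mul']
  split_ifs with hle
  · rw [one_mul, coeff_expand_of_not_dvd (i := u)]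
    contrapose! hu
    obtain ⟨q, rfl⟩ := exists_add_of_le hle
    rw [add_tsub_cancel_left] at hu
    have : ((d - 1) • indicatorExp s + q + indicatorExp s) u = q u + d * indicatorExp s u := by
      obtain ⟨e, rfl⟩ := Nat.exists_eq_succ_of_ne_zero hd.ne'
      simp only [Finsupp.add_apply, Finsupp.smul_apply, smul_eq_mul, Nat.succ_eq_add_one,
        Nat.add_sub_cancel]
      ring
    rw [this]
    exact dvd_add hu (dvd_mul_right _ _)
  · rfl

lemma totalDiff_totalHomotopy {d : ℕ} (hd : 0 < d)
    (U : Finset (Fin n) → MvPolynomial (Fin n) K) :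
    totalDiff (totalHomotopy d U) + totalHomotopy d (totalDiff U) +
      totalExpand d (totalExtract hd U) = U := by
  ext s m
  rw [Pi.add_apply, coeff_add, Pi.add_apply]
  by_cases h : ∀ u, d ∣ (m + indicatorExp s) u
  · rw [coeff_diff_homotopy_of_dvd U h, coeff_totalExpand_totalExtract hd U h, zero_add]
  · rw [coeff_diff_homotopy_of_not_dvd U h, coeff_totalExpand_of_not_dvd hd _ h, add_zero]

lemma totalDiff_totalExpand {d : ℕ} (hd : 0 < d)
    (U : Finset (Fin n) → MvPolynomial (Fin n) K) :
    totalDiff (totalExpand d U) = totalExpand d (totalDiff U) := by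
  ext1 s
  rw [totalExpand_apply, totalDiff_apply, totalDiff_apply, map_sum, Finset.mul_sum]
  refine Finset.sum_congr rfl fun t _ => ?_
  split_ifs with ht
  · simp
  · rw [totalExpand_apply, map_smul, map_mul, expand_X, mul_smul_comm, ← mul_assoc, ← mul_assoc,
      X_pow_eq_monomial, X, monomial_mul, monomial_mul]
    congr 4
    ext u
    simp only [Finsupp.add_apply, Finsupp.smul_apply, smul_eq_mul, indicatorExp_apply,
      Finset.mem_insert, Finsupp.single_apply]
    by_cases hu : u = t
    · subst hu
      simp only [if_true, true_or, if_neg ht]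
      omega
    · simp [hu, Ne.symm hu]

lemma totalDiff_totalExtract {d : ℕ} (hd : 0 < d)
    (U : Finset (Fin n) → MvPolynomial (Fin n) K) :
    totalDiff (totalExtract hd U) = totalExtract hd (totalDiff U) := by
  ext s m
  rw [totalExtract_apply, coeff_extract, coeff_totalDiff, coeff_totalDiff]
  refine Finset.sum_congr rfl fun t _ => ?_
  by_cases ht : t ∈ s
  · simp [ht]
  · by_cases hm : m t = 0
    · simp [ht, hm, indicatorExp_apply]
    · rw [if_pos ⟨ht, hm⟩, if_pos ⟨ht, by simp [hm, hd.ne']⟩, totalExtract_apply, coeff_extract]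
      congr 2
      ext u
      simp only [Finsupp.add_apply, Finsupp.smul_apply, Finsupp.tsub_apply, smul_eq_mul,
        indicatorExp_apply, Finset.mem_insert, Finsupp.single_apply]
      by_cases hu : u = t
      · subst hu
        obtain ⟨b, hb⟩ := Nat.exists_eq_succ_of_ne_zero hm
        simp only [if_true, true_or, if_neg ht, hb, Nat.succ_eq_add_one, Nat.add_sub_cancel,
          mul_add]
        omega
      · simp [hu, Ne.symm hu]

/-- The extension of a homogeneous component of the Koszul complex of `I` by zero. -/
noncomputable def koszulEmbed (I : Ideal (MvPolynomial (Fin n) K)) (i : ℕ) (k : ℤ) :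
    (KoszulIdx n i → idealPiece I k) →ₗ[K] (Finset (Fin n) → MvPolynomial (Fin n) K) :=
  LinearMap.pi fun s => if h : s.card = i then
    (idealPiece I k).subtype ∘ₗ LinearMap.proj (⟨s, h⟩ : KoszulIdx n i) else 0

lemma koszulEmbed_of_card_eq {I : Ideal (MvPolynomial (Fin n) K)} {i : ℕ} {k : ℤ}
    (u : KoszulIdx n i → idealPiece I k) {s : Finset (Fin n)} (h : s.card = i) :
    koszulEmbed I i k u s = u ⟨s, h⟩ := by
  rw [koszulEmbed, LinearMap.pi_apply, dif_pos h]
  rfl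

lemma koszulEmbed_of_card_ne {I : Ideal (MvPolynomial (Fin n) K)} {i : ℕ} {k : ℤ}
    (u : KoszulIdx n i → idealPiece I k) {s : Finset (Fin n)} (h : s.card ≠ i) :
    koszulEmbed I i k u s = 0 := by
  rw [koszulEmbed, LinearMap.pi_apply, dif_neg h]
  rfl

lemma koszulEmbed_injective (I : Ideal (MvPolynomial (Fin n) K)) (i : ℕ) (k : ℤ) :
    Function.Injective (koszulEmbed I i k) := fun u v h => by
  ext1 s
  have := congrFun h s.1
  rw [koszulEmbed_of_card_eq _ s.2, koszulEmbed_of_card_eq _ s.2] at this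
  exact Subtype.ext this

lemma mem_range_koszulEmbed {I : Ideal (MvPolynomial (Fin n) K)} {i : ℕ} {k : ℤ}
    {U : Finset (Fin n) → MvPolynomial (Fin n) K} :
    U ∈ LinearMap.range (koszulEmbed I i k) ↔
      ∀ s : Finset (Fin n), (s.card = i → U s ∈ idealPiece I k) ∧ (s.card ≠ i → U s = 0) := by
  constructor
  · rintro ⟨u, rfl⟩ s
    refine ⟨fun h => ?_, fun h => koszulEmbed_of_card_ne u h⟩
    rw [koszulEmbed_of_card_eq u h]
    exact (u _).2
  · intro h
    refine ⟨fun s => ⟨U s.1, (h s.1).1 s.2⟩, ?_⟩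
    ext1 s
    by_cases hs : s.card = i
    · rw [koszulEmbed_of_card_eq _ hs]
    · rw [koszulEmbed_of_card_ne _ hs, (h s).2 hs]

lemma coe_koszulDiff_apply (I : Ideal (MvPolynomial (Fin n) K)) (i : ℕ) (j : ℤ)
    (u : KoszulIdx n (i + 1) → idealPiece I (j - (i + 1 : ℕ))) (s : KoszulIdx n i) :
    (koszulDiff I i j u s : MvPolynomial (Fin n) K) =
      ∑ s' : KoszulIdx n (i + 1), ∑ t ∈ s'.1, if s'.1.erase t = s.1 then
        koszulSign K s'.1 t • (X t * (u s' : MvPolynomial (Fin n) K)) else 0 := by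
  simp only [koszulDiff, LinearMap.sum_apply, Finset.sum_apply, AddSubmonoidClass.coe_finsetSum]
  refine Finset.sum_congr rfl fun s' _ => ?_
  rw [← Finset.sum_attach s'.1]
  refine Finset.sum_congr rfl fun t _ => ?_
  simp only [LinearMap.smul_apply, Pi.smul_apply, LinearMap.comp_apply, LinearMap.single_apply,
    Pi.single_apply, Submodule.coe_smul]
  by_cases h : s'.1.erase t.1 = s.1
  · rw [if_pos h, if_pos (Subtype.ext h.symm)]
    rfl
  · rw [if_neg h, if_neg (fun h' => h (congrArg Subtype.val h').symm)]
    simp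

lemma totalDiff_koszulEmbed (I : Ideal (MvPolynomial (Fin n) K)) (i : ℕ) (j : ℤ)
    (u : KoszulIdx n (i + 1) → idealPiece I (j - (i + 1 : ℕ))) :
    totalDiff (koszulEmbed I (i + 1) (j - (i + 1 : ℕ)) u) =
      koszulEmbed I i (j - (i : ℕ)) (koszulDiff I i j u) := by
  ext1 s
  rw [totalDiff_apply]
  by_cases hs : s.card = i
  · rw [koszulEmbed_of_card_eq _ hs, coe_koszulDiff_apply]
    have h1 : ∀ s' : KoszulIdx n (i + 1), (∑ t ∈ s'.1, if s'.1.erase t = s then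
        koszulSign K s'.1 t • (X t * (u s' : MvPolynomial (Fin n) K)) else 0) =
        ∑ t : Fin n, if t ∈ s'.1 ∧ s'.1.erase t = s then
          koszulSign K s'.1 t • (X t * (u s' : MvPolynomial (Fin n) K)) else 0 := by
      intro s'
      simp only [ite_and]
      rw [Finset.sum_ite_mem, Finset.univ_inter]
    simp only [h1]
    rw [Finset.sum_comm]
    refine Finset.sum_congr rfl fun t _ => ?_
    split_ifs with ht
    · refine (Finset.sum_eq_zero fun s' _ => if_neg ?_).symm
      rintro ⟨-, rfl⟩
      simp at ht
    · have hc : (insert t s).card = i + 1 := by rw [Finset.card_insert_of_notMem ht, hs]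
      rw [Finset.sum_eq_single (⟨insert t s, hc⟩ : KoszulIdx n (i + 1))]
      · rw [if_pos ⟨by simp, Finset.erase_insert ht⟩, koszulEmbed_of_card_eq _ hc,
          ← koszulSign_erase_self (insert t s), Finset.erase_insert ht]
      · intro s' _ hne
        refine if_neg ?_
        rintro ⟨h, h'⟩
        exact hne (Subtype.ext (by simp only [← h', Finset.insert_erase h]))
      · simp
  · rw [koszulEmbed_of_card_ne _ hs]
    refine Finset.sum_eq_zero fun t _ => ?_
    split_ifs with ht
    · rfl
    · rw [koszulEmbed_of_card_ne, mul_zero, smul_zero]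
      rw [Finset.card_insert_of_notMem ht]
      omega

lemma map_koszulEmbed_koszulCycles (I : Ideal (MvPolynomial (Fin n) K)) (i : ℕ) (j : ℤ) :
    (koszulCycles I i j).map (koszulEmbed I i (j - (i : ℕ))) =
      LinearMap.range (koszulEmbed I i (j - (i : ℕ))) ⊓ LinearMap.ker totalDiff := by
  cases i with
  | zero =>
    rw [koszulCycles, Submodule.map_top, eq_comm, inf_eq_left]
    rintro _ ⟨u, rfl⟩
    rw [LinearMap.mem_ker]
    ext1 s
    rw [totalDiff_apply]
    refine Finset.sum_eq_zero fun t _ => ?_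
    split_ifs with ht
    · rfl
    · rw [koszulEmbed_of_card_ne, mul_zero, smul_zero]
      simp
  | succ i =>
    ext U
    constructor
    · rintro ⟨u, hu, rfl⟩
      refine ⟨⟨u, rfl⟩, ?_⟩
      rw [SetLike.mem_coe, LinearMap.mem_ker, totalDiff_koszulEmbed, LinearMap.mem_ker.mp hu,
        map_zero]
    · rintro ⟨⟨u, rfl⟩, hu⟩
      refine ⟨u, ?_, rfl⟩
      rw [SetLike.mem_coe, LinearMap.mem_ker, totalDiff_koszulEmbed] at hu
      exact LinearMap.mem_ker.mpr (koszulEmbed_injective _ _ _ (by rw [hu, map_zero]))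

lemma map_koszulEmbed_range_koszulDiff (I : Ideal (MvPolynomial (Fin n) K)) (i : ℕ) (j : ℤ) :
    (LinearMap.range (koszulDiff I i j)).map (koszulEmbed I i (j - (i : ℕ))) =
      (LinearMap.range (koszulEmbed I (i + 1) (j - (i + 1 : ℕ)))).map totalDiff := by
  rw [← LinearMap.range_comp, ← LinearMap.range_comp]
  exact congrArg LinearMap.range (LinearMap.ext fun u => (totalDiff_koszulEmbed I i j u).symm)

/-- The cycles of the Koszul complex, extended by zero. -/
noncomputable def totalCycles (I : Ideal (MvPolynomial (Fin n) K)) (i : ℕ) (j : ℤ) :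
    Submodule K (Finset (Fin n) → MvPolynomial (Fin n) K) :=
  LinearMap.range (koszulEmbed I i (j - (i : ℕ))) ⊓ LinearMap.ker totalDiff

/-- The boundaries of the Koszul complex, extended by zero. -/
noncomputable def totalBoundaries (I : Ideal (MvPolynomial (Fin n) K)) (i : ℕ) (j : ℤ) :
    Submodule K (Finset (Fin n) → MvPolynomial (Fin n) K) :=
  (LinearMap.range (koszulEmbed I (i + 1) (j - (i + 1 : ℕ)))).map totalDiff

instance finite_totalCycles (I : Ideal (MvPolynomial (Fin n) K)) (i : ℕ) (j : ℤ) :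
    Module.Finite K (totalCycles I i j) := by
  rw [totalCycles]
  exact Submodule.finiteDimensional_inf_left _ _

lemma gradedBetti_eq_finrank_sub (I : Ideal (MvPolynomial (Fin n) K)) (i : ℕ) (j : ℤ) :
    gradedBetti I i j = Module.finrank K (totalCycles I i j) -
      Module.finrank K ↥(totalBoundaries I i j ⊓ totalCycles I i j) := by
  have hinj := koszulEmbed_injective I i (j - (i : ℕ))
  rw [gradedBetti, totalCycles, totalBoundaries, ← map_koszulEmbed_koszulCycles,
    ← map_koszulEmbed_range_koszulDiff, ← Submodule.map_inf _ hinj,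
    LinearEquiv.finrank_eq (Submodule.equivMapOfInjective _ hinj (koszulCycles I i j)),
    LinearEquiv.finrank_eq (Submodule.equivMapOfInjective _ hinj
      (LinearMap.range (koszulDiff I i j) ⊓ koszulCycles I i j))]

lemma expand_mem_map {d : ℕ} {I : Ideal (MvPolynomial (Fin n) K)}
    {f : MvPolynomial (Fin n) K} (hf : f ∈ I) : expand d f ∈ I.map (expand d) :=
  Ideal.mem_map_of_mem _ hf

lemma extract_mem {d : ℕ} (hd : 0 < d) (s : Finset (Fin n)) {I : Ideal (MvPolynomial (Fin n) K)}
    {g : MvPolynomial (Fin n) K} (hg : g ∈ I.map (expand d)) : extract hd s g ∈ I := by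
  refine Submodule.span_induction
    (p := fun g _ => ∀ r : MvPolynomial (Fin n) K, extract hd s (g * r) ∈ I)
    ?_ ?_ ?_ ?_ hg 1 |> fun h => by rwa [mul_one] at h
  · rintro _ ⟨f, hf, rfl⟩ r
    exact extract_expand_mul hd s f r ▸ I.mul_mem_right _ hf
  · simp
  · intro f g _ _ hf hg r
    rw [add_mul, map_add]
    exact I.add_mem (hf r) (hg r)
  · intro a f _ hf r
    rw [smul_eq_mul, mul_comm a, mul_assoc]
    exact hf _

lemma divFirst_mem {d : ℕ} {s : Finset (Fin n)} {t : Fin n} (ht : t ∈ s)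
    {I : Ideal (MvPolynomial (Fin n) K)} {g : MvPolynomial (Fin n) K} (hg : g ∈ I.map (expand d)) :
    divFirst d s t g ∈ I.map (expand d) := by
  refine Submodule.span_induction
    (p := fun g _ => ∀ r : MvPolynomial (Fin n) K, divFirst d s t (g * r) ∈ I.map (expand d))
    ?_ ?_ ?_ ?_ hg 1 |> fun h => by rwa [mul_one] at h
  · rintro _ ⟨f, hf, rfl⟩ r
    exact divFirst_expand_mul ht f r ▸ Ideal.mul_mem_right _ _ (expand_mem_map hf)
  · simp
  · intro f g _ _ hf hg r
    rw [add_mul, map_add]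
    exact Ideal.add_mem _ (hf r) (hg r)
  · intro a f _ hf r
    rw [smul_eq_mul, mul_comm a, mul_assoc]
    exact hf _

lemma totalHomotopy_mem_range {d : ℕ} {I : Ideal (MvPolynomial (Fin n) K)} {i : ℕ} {j : ℤ}
    {U : Finset (Fin n) → MvPolynomial (Fin n) K}
    (hU : U ∈ LinearMap.range (koszulEmbed (I.map (expand d)) i (j - (i : ℕ)))) :
    totalHomotopy d U ∈
      LinearMap.range (koszulEmbed (I.map (expand d)) (i + 1) (j - (i + 1 : ℕ))) := by
  classical
  rw [mem_range_koszulEmbed] at hU ⊢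
  refine fun s => ⟨fun hs => ?_, fun hs => ?_⟩
  · rw [totalHomotopy_apply]
    refine Submodule.sum_mem _ fun t _ => ?_
    split_ifs with ht
    · refine Submodule.smul_mem _ _ ?_
      have h := (hU (s.erase t)).1 (by rw [Finset.card_erase_of_mem ht]; omega)
      rw [mem_idealPiece_iff] at h ⊢
      refine ⟨divFirst_mem ht h.1, fun m hm => ?_⟩
      rw [divFirst, coeff_selectCoeff] at hm
      split_ifs at hm
      · have := h.2 _ hm
        rw [map_add, Finsupp.degree_single] at this
        push_cast at this ⊢
        linarith
      · exact absurd rfl hm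
    · exact Submodule.zero_mem _
  · rw [totalHomotopy_apply]
    refine Finset.sum_eq_zero fun t _ => ?_
    split_ifs with ht
    · rw [(hU (s.erase t)).2, map_zero, smul_zero]
      have := Finset.card_pos.mpr ⟨t, ht⟩
      rw [Finset.card_erase_of_mem ht]
      omega
    · rfl

lemma totalExpand_mem_range {d : ℕ} (hd : 0 < d) {I : Ideal (MvPolynomial (Fin n) K)} {i : ℕ}
    {j : ℤ} {U : Finset (Fin n) → MvPolynomial (Fin n) K}
    (hU : U ∈ LinearMap.range (koszulEmbed I i (j - (i : ℕ)))) :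
    totalExpand d U ∈ LinearMap.range (koszulEmbed (I.map (expand d)) i (j * d - (i : ℕ))) := by
  rw [mem_range_koszulEmbed] at hU ⊢
  refine fun s => ⟨fun hs => ?_, fun hs => ?_⟩
  · have h := (hU s).1 hs
    rw [mem_idealPiece_iff] at h ⊢
    refine ⟨Ideal.mul_mem_left _ _ (expand_mem_map h.1), fun m hm => ?_⟩
    have hdvd : ∀ u, d ∣ (m + indicatorExp s) u := by
      by_contra hne
      exact hm (coeff_totalExpand_of_not_dvd hd U hne)
    obtain ⟨q, rfl⟩ := exists_eq_smul_add_indicatorExp hd hdvd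
    rw [coeff_totalExpand hd] at hm
    have := h.2 q hm
    rw [map_add, map_nsmul, map_nsmul, degree_indicatorExp, hs]
    push_cast [Nat.cast_sub (Nat.one_le_iff_ne_zero.mpr hd.ne'), smul_eq_mul]
    rw [this]
    ring
  · rw [totalExpand_apply, (hU s).2 hs, map_zero, mul_zero]

lemma totalExtract_mem_range {d : ℕ} (hd : 0 < d) {I : Ideal (MvPolynomial (Fin n) K)} {i : ℕ}
    {j : ℤ} {U : Finset (Fin n) → MvPolynomial (Fin n) K}
    (hU : U ∈ LinearMap.range (koszulEmbed (I.map (expand d)) i (j * d - (i : ℕ)))) :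
    totalExtract hd U ∈ LinearMap.range (koszulEmbed I i (j - (i : ℕ))) := by
  rw [mem_range_koszulEmbed] at hU ⊢
  refine fun s => ⟨fun hs => ?_, fun hs => ?_⟩
  · have h := (hU s).1 hs
    rw [mem_idealPiece_iff] at h ⊢
    refine ⟨extract_mem hd s h.1, fun m hm => ?_⟩
    rw [totalExtract_apply, coeff_extract] at hm
    have := h.2 _ hm
    rw [map_add, map_nsmul, map_nsmul, degree_indicatorExp, hs] at this
    have hd' : (d : ℤ) ≠ 0 := by exact_mod_cast hd.ne'
    apply mul_left_cancel₀ hd'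
    push_cast [Nat.cast_sub (Nat.one_le_iff_ne_zero.mpr hd.ne'), smul_eq_mul] at this
    linarith
  · rw [totalExtract_apply, (hU s).2 hs, map_zero]

lemma totalExtract_eq_zero {d : ℕ} (hd : 0 < d) {I : Ideal (MvPolynomial (Fin n) K)} {i : ℕ}
    {j : ℤ} (hj : ¬ (d : ℤ) ∣ j) {U : Finset (Fin n) → MvPolynomial (Fin n) K}
    (hU : U ∈ LinearMap.range (koszulEmbed I i (j - (i : ℕ)))) :
    totalExtract hd U = 0 := by
  rw [mem_range_koszulEmbed] at hU
  ext s m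
  rw [totalExtract_apply, coeff_extract, Pi.zero_apply, coeff_zero]
  by_cases hs : s.card = i
  · by_contra hne
    have := ((mem_idealPiece_iff _ _ _).mp ((hU s).1 hs)).2 _ hne
    rw [map_add, map_nsmul, map_nsmul, degree_indicatorExp, hs] at this
    push_cast [Nat.cast_sub (Nat.one_le_iff_ne_zero.mpr hd.ne'), smul_eq_mul] at this
    exact hj ⟨m.degree + i, by linarith⟩
  · rw [(hU s).2 hs, coeff_zero]

lemma totalExpand_injective {d : ℕ} (hd : 0 < d) :
    Function.Injective (totalExpand (K := K) (n := n) d) :=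
  Function.LeftInverse.injective (totalExtract_totalExpand hd)

lemma sub_totalExpand_totalExtract_mem {d : ℕ} (hd : 0 < d)
    {I : Ideal (MvPolynomial (Fin n) K)} {i : ℕ} {j : ℤ}
    {U : Finset (Fin n) → MvPolynomial (Fin n) K} (hU : U ∈ totalCycles (I.map (expand d)) i j) :
    U - totalExpand d (totalExtract hd U) ∈ totalBoundaries (I.map (expand d)) i j := by
  refine ⟨totalHomotopy d U, totalHomotopy_mem_range hU.1, ?_⟩
  have h := totalDiff_totalHomotopy hd U
  rw [LinearMap.mem_ker.mp hU.2, map_zero, add_zero] at h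
  exact eq_sub_of_add_eq h

lemma totalExpand_mem_totalCycles {d : ℕ} (hd : 0 < d) {I : Ideal (MvPolynomial (Fin n) K)}
    {i : ℕ} {j : ℤ} {U : Finset (Fin n) → MvPolynomial (Fin n) K} (hU : U ∈ totalCycles I i j) :
    totalExpand d U ∈ totalCycles (I.map (expand d)) i (j * d) := by
  refine ⟨totalExpand_mem_range hd hU.1, ?_⟩
  rw [SetLike.mem_coe, LinearMap.mem_ker, totalDiff_totalExpand hd, LinearMap.mem_ker.mp hU.2,
    map_zero]

lemma totalExtract_mem_totalCycles {d : ℕ} (hd : 0 < d) {I : Ideal (MvPolynomial (Fin n) K)}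
    {i : ℕ} {j : ℤ} {U : Finset (Fin n) → MvPolynomial (Fin n) K}
    (hU : U ∈ totalCycles (I.map (expand d)) i (j * d)) :
    totalExtract hd U ∈ totalCycles I i j := by
  refine ⟨totalExtract_mem_range hd hU.1, ?_⟩
  rw [SetLike.mem_coe, LinearMap.mem_ker, totalDiff_totalExtract hd, LinearMap.mem_ker.mp hU.2,
    map_zero]

lemma totalExpand_mem_totalBoundaries {d : ℕ} (hd : 0 < d) {I : Ideal (MvPolynomial (Fin n) K)}
    {i : ℕ} {j : ℤ} {U : Finset (Fin n) → MvPolynomial (Fin n) K}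
    (hU : U ∈ totalBoundaries I i j) :
    totalExpand d U ∈ totalBoundaries (I.map (expand d)) i (j * d) := by
  obtain ⟨V, hV, rfl⟩ := hU
  exact ⟨totalExpand d V, totalExpand_mem_range hd hV, totalDiff_totalExpand hd V⟩

lemma totalExtract_mem_totalBoundaries {d : ℕ} (hd : 0 < d)
    {I : Ideal (MvPolynomial (Fin n) K)} {i : ℕ} {j : ℤ}
    {U : Finset (Fin n) → MvPolynomial (Fin n) K}
    (hU : U ∈ totalBoundaries (I.map (expand d)) i (j * d)) :
    totalExtract hd U ∈ totalBoundaries I i j := by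
  obtain ⟨V, hV, rfl⟩ := hU
  exact ⟨totalExtract hd V, totalExtract_mem_range hd hV, totalDiff_totalExtract hd V⟩

lemma gradedBetti_map_expand {d : ℕ} (hd : 0 < d) (I : Ideal (MvPolynomial (Fin n) K)) (i : ℕ)
    (j : ℤ) : gradedBetti (I.map (expand d)) i (j * d) = gradedBetti I i j := by
  rw [gradedBetti_eq_finrank_sub, gradedBetti_eq_finrank_sub]
  set Z := totalCycles I i j
  set B := totalBoundaries I i j
  set Z' := totalCycles (I.map (expand d)) i (j * d)
  set B' := totalBoundaries (I.map (expand d)) i (j * d)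
  have hsup : Z.map (totalExpand d) ⊔ (B' ⊓ Z') = Z' := by
    refine le_antisymm (sup_le ?_ inf_le_right) fun U hU => ?_
    · rintro _ ⟨U, hU, rfl⟩
      exact totalExpand_mem_totalCycles hd hU
    · have h := totalExtract_mem_totalCycles hd hU
      rw [← add_sub_cancel (totalExpand d (totalExtract hd U)) U]
      exact Submodule.add_mem_sup ⟨_, h, rfl⟩ ⟨sub_totalExpand_totalExtract_mem hd hU,
        Z'.sub_mem hU (totalExpand_mem_totalCycles hd h)⟩
  have hinf : Z.map (totalExpand d) ⊓ (B' ⊓ Z') = (B ⊓ Z).map (totalExpand d) := by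
    apply le_antisymm
    · rintro _ ⟨⟨U, hU, rfl⟩, hB, -⟩
      refine ⟨U, ⟨?_, hU⟩, rfl⟩
      rw [← totalExtract_totalExpand hd U]
      exact totalExtract_mem_totalBoundaries hd hB
    · rintro _ ⟨U, hU, rfl⟩
      exact ⟨⟨U, hU.2, rfl⟩, totalExpand_mem_totalBoundaries hd hU.1,
        totalExpand_mem_totalCycles hd hU.2⟩
  have hfin : Module.Finite K ↥(B' ⊓ Z') := Submodule.finiteDimensional_inf_right _ _
  have h := Submodule.finrank_sup_add_finrank_inf_eq (Z.map (totalExpand d)) (B' ⊓ Z')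
  have hinj := totalExpand_injective (K := K) (n := n) hd
  rw [hsup, hinf,
    ← LinearEquiv.finrank_eq (Submodule.equivMapOfInjective _ hinj Z),
    ← LinearEquiv.finrank_eq (Submodule.equivMapOfInjective _ hinj (B ⊓ Z))] at h
  have h1 := Submodule.finrank_mono (inf_le_right : B ⊓ Z ≤ Z)
  have h2 := Submodule.finrank_mono (inf_le_right : B' ⊓ Z' ≤ Z')
  omega

lemma gradedBetti_map_expand_of_not_dvd {d : ℕ} (hd : 0 < d)
    (I : Ideal (MvPolynomial (Fin n) K)) (i : ℕ) {j : ℤ} (hj : ¬ (d : ℤ) ∣ j) :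
    gradedBetti (I.map (expand d)) i j = 0 := by
  rw [gradedBetti_eq_finrank_sub, inf_eq_right.mpr, Nat.sub_self]
  intro U hU
  have h := sub_totalExpand_totalExtract_mem hd hU
  rwa [totalExtract_eq_zero hd hj hU.1, map_zero, sub_zero] at h

end KoszulPowerMap

/-- Let `α : R → R` be the `K`-algebra map of `R = K[x_1,…,x_n]` with `α(x_i) = x_i^d`,
`d > 0`, and `I' = α(I)R` for a homogeneous ideal `I`.  Then the graded Betti numbers
satisfy `β_{i,jd}(I') = β_{i,j}(I)` for all `i, j`, and `β_{i,j}(I') = 0` when `d ∤ j`. -/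
theorem gradedBetti_power_map {n : ℕ} (d : ℕ) (hd : 0 < d)
    (I : Ideal (MvPolynomial (Fin n) K)) (hI : IsHomogeneousIdeal I) :
    (∀ (i : ℕ) (j : ℤ),
        gradedBetti (Ideal.map
          (aeval (fun i => (X i : MvPolynomial (Fin n) K) ^ d) :
            MvPolynomial (Fin n) K →ₐ[K] MvPolynomial (Fin n) K) I) i (j * d) =
          gradedBetti I i j) ∧
      (∀ (i : ℕ) (j : ℤ), ¬ (d : ℤ) ∣ j →
        gradedBetti (Ideal.map
          (aeval (fun i => (X i : MvPolynomial (Fin n) K) ^ d) :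
            MvPolynomial (Fin n) K →ₐ[K] MvPolynomial (Fin n) K) I) i j = 0) := by
  exact ⟨fun i j => gradedBetti_map_expand hd I i j,
    fun i _ hj => gradedBetti_map_expand_of_not_dvd hd I i hj⟩
end

section
/- Let K be a field, R = K[x_1,...,x_n], d a positive integer, α: R → R the K-algebra map with α(x_i) = x_i^d, and I a homogeneous ideal with I' = α(I)R. For i = 0,...,projdim(I) set t_i(I) = max{ j : β_{i,j}(I) ≠ 0 }. Then t_i(I') = d·t_i(I) for all i. -/
open MvPolynomial

variable {K : Type} [Field K]

namespace PowerMap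

variable {n : ℕ}

/-- The polynomial whose `a`-th coefficient is `coeff (σ a) p` if `q a` holds, and `0` otherwise. -/
noncomputable def coeffPullFun (σ : (Fin n →₀ ℕ) → (Fin n →₀ ℕ)) (hσ : Function.Injective σ)
    (q : (Fin n →₀ ℕ) → Prop) [DecidablePred q] (p : MvPolynomial (Fin n) K) :
    MvPolynomial (Fin n) K :=
  AddMonoidAlgebra.ofCoeff
    ((Finsupp.comapDomain σ (AddMonoidAlgebra.coeff p) hσ.injOn).filter q)

lemma coeff_coeffPullFun (σ : (Fin n →₀ ℕ) → (Fin n →₀ ℕ)) (hσ : Function.Injective σ)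
    (q : (Fin n →₀ ℕ) → Prop) [DecidablePred q] (p : MvPolynomial (Fin n) K) (a : Fin n →₀ ℕ) :
    coeff a (coeffPullFun σ hσ q p) = if q a then coeff (σ a) p else 0 :=
  Finsupp.filter_apply _ _ _

/-- `coeffPullFun` as a linear map. -/
noncomputable def coeffPull (σ : (Fin n →₀ ℕ) → (Fin n →₀ ℕ)) (hσ : Function.Injective σ)
    (q : (Fin n →₀ ℕ) → Prop) [DecidablePred q] :
    MvPolynomial (Fin n) K →ₗ[K] MvPolynomial (Fin n) K where
  toFun := coeffPullFun σ hσ q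
  map_add' p r := by
    ext a
    simp only [coeff_coeffPullFun, coeff_add]
    split_ifs <;> simp
  map_smul' c p := by
    ext a
    simp only [coeff_coeffPullFun, coeff_smul, RingHom.id_apply]
    split_ifs <;> simp

lemma coeff_coeffPull (σ : (Fin n →₀ ℕ) → (Fin n →₀ ℕ)) (hσ : Function.Injective σ)
    (q : (Fin n →₀ ℕ) → Prop) [DecidablePred q] (p : MvPolynomial (Fin n) K) (a : Fin n →₀ ℕ) :
    coeff a (coeffPull σ hσ q p) = if q a then coeff (σ a) p else 0 :=
  coeff_coeffPullFun σ hσ q p a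

lemma coeff_X_mul_eq_ite (t : Fin n) (p : MvPolynomial (Fin n) K) (a : Fin n →₀ ℕ) :
    coeff a (X t * p) = if a t = 0 then 0 else coeff (a - Finsupp.single t 1) p := by
  rw [coeff_X_mul']
  simp only [Finsupp.mem_support_iff]
  split_ifs <;> simp_all

lemma coeff_X_pow_mul_eq_ite (d : ℕ) (t : Fin n) (p : MvPolynomial (Fin n) K)
    (a : Fin n →₀ ℕ) :
    coeff a (X t ^ d * p) = if d ≤ a t then coeff (a - Finsupp.single t d) p else 0 := by
  rw [X_pow_eq_monomial, coeff_monomial_mul']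
  simp only [one_mul, Finsupp.single_le_iff]

/-- An additive map which is semilinear along `expand d` maps the extension of `I` along `expand d`
into any ideal `J` that contains the corresponding twist of `I`. -/
lemma map_mem_of_semilinear {d : ℕ} {I J : Ideal (MvPolynomial (Fin n) K)}
    (T : MvPolynomial (Fin n) K →ₗ[K] MvPolynomial (Fin n) K)
    (g : MvPolynomial (Fin n) K →ₐ[K] MvPolynomial (Fin n) K) (hg : ∀ m ∈ I, g m ∈ J)
    (hT : ∀ t p, T (X t ^ d * p) = g (X t) * T p) {p : MvPolynomial (Fin n) K}
    (hp : p ∈ I.map (expand d)) : T p ∈ J := by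
  have key (m r : MvPolynomial (Fin n) K) : T (expand d m * r) = g m * T r := by
    induction m using MvPolynomial.induction_on generalizing r with
    | C c => rw [← algebraMap_eq, AlgHom.commutes, AlgHom.commutes, ← Algebra.smul_def, map_smul,
        Algebra.smul_def]
    | add p q hp hq => simp only [add_mul, map_add, hp, hq]
    | mul_X p t hp =>
      rw [map_mul (expand d), map_mul g, mul_assoc, expand_X, hp, hT, mul_assoc]
  suffices h : ∀ r, T (r * p) ∈ J by simpa using h 1
  induction hp using Submodule.span_induction with
  | mem x hx =>
    obtain ⟨m, hm, rfl⟩ := hx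
    intro r
    rw [mul_comm]
    exact (key m r).symm ▸ J.mul_mem_right _ (hg m hm)
  | zero => simp
  | add x y _ _ hx hy => exact fun r => by rw [mul_add, map_add]; exact J.add_mem (hx r) (hy r)
  | smul a x _ hx => exact fun r => by rw [smul_eq_mul, ← mul_assoc]; exact hx _

/-! ### Koszul chains as functions on all subsets of the variables -/

lemma mem_idealPiece_iff {I : Ideal (MvPolynomial (Fin n) K)} {k : ℤ}
    {p : MvPolynomial (Fin n) K} :
    p ∈ idealPiece I k ↔ p ∈ I ∧ ∀ a, coeff a p ≠ 0 → (a.degree : ℤ) = k := by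
  unfold idealPiece
  split_ifs with h
  · rw [Submodule.mem_inf, mem_homogeneousSubmodule, IsHomogeneous, IsWeightedHomogeneous]
    refine and_congr Iff.rfl (forall_congr' fun a => imp_congr_right fun _ => ?_)
    rw [show Finsupp.weight 1 a = a.degree from
      (DFunLike.congr_fun (Finsupp.degree_eq_weight_one (R := ℕ)) a).symm]
    omega
  · refine ⟨fun hp => by simp_all, fun hp => ?_⟩
    rw [Submodule.mem_bot, eq_zero_iff]
    intro a
    by_contra ha
    have := hp.2 a ha
    omega

/-- Degree-`j` Koszul chains in homological degree `i`, extended by zero to all subsets. -/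
def chains (I : Ideal (MvPolynomial (Fin n) K)) (i : ℕ) (j : ℤ) :
    Submodule K (Finset (Fin n) → MvPolynomial (Fin n) K) where
  carrier := {f | (∀ s, f s ∈ idealPiece I (j - i)) ∧ ∀ s, s.card ≠ i → f s = 0}
  add_mem' hf hg := ⟨fun s => add_mem (hf.1 s) (hg.1 s),
    fun s hs => by rw [Pi.add_apply, hf.2 s hs, hg.2 s hs, add_zero]⟩
  zero_mem' := ⟨fun _ => zero_mem _, fun _ _ => rfl⟩
  smul_mem' c _ hf := ⟨fun s => Submodule.smul_mem _ c (hf.1 s),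
    fun s hs => by rw [Pi.smul_apply, hf.2 s hs, smul_zero]⟩

/-- The Koszul sign of the variable `t` relative to the set `s`. -/
def koszulSign (K : Type) [Field K] (t : Fin n) (s : Finset (Fin n)) : K :=
  (-1) ^ (s.filter (fun u => u < t)).card

/-- The Koszul differential on functions on all subsets. -/
noncomputable def diff : (Finset (Fin n) → MvPolynomial (Fin n) K) →ₗ[K]
    (Finset (Fin n) → MvPolynomial (Fin n) K) where
  toFun f s := ∑ t ∈ sᶜ, koszulSign K t s • (X t * f (insert t s))
  map_add' f g := by
    ext1 s
    simp only [Pi.add_apply, mul_add, smul_add, Finset.sum_add_distrib]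
  map_smul' c f := by
    ext1 s
    simp only [Pi.smul_apply, RingHom.id_apply, Finset.smul_sum, mul_smul_comm, smul_comm c]

lemma diff_apply (f : Finset (Fin n) → MvPolynomial (Fin n) K) (s : Finset (Fin n)) :
    diff f s = ∑ t ∈ sᶜ, koszulSign K t s • (X t * f (insert t s)) := rfl

/-- There is a Koszul cycle which is not a boundary. -/
def HasHomology (I : Ideal (MvPolynomial (Fin n) K)) (i : ℕ) (j : ℤ) : Prop :=
  ∃ f ∈ chains I i j, diff f = 0 ∧ ∀ g ∈ chains I (i + 1) j, diff g ≠ f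

/-- Extension by zero of a family indexed by the subsets of size `i`. -/
noncomputable def extend {I : Ideal (MvPolynomial (Fin n) K)} {i : ℕ} {k : ℤ}
    (f : KoszulIdx n i → idealPiece I k) (s : Finset (Fin n)) : MvPolynomial (Fin n) K :=
  if h : s.card = i then f ⟨s, h⟩ else 0

lemma extend_mem {I : Ideal (MvPolynomial (Fin n) K)} {i : ℕ} {j : ℤ}
    (f : KoszulIdx n i → idealPiece I (j - (i : ℕ))) : extend f ∈ chains I i j := by
  refine ⟨fun s => ?_, fun s hs => dif_neg hs⟩
  unfold extend
  split_ifs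
  exacts [(f _).2, zero_mem _]

lemma exists_extend_eq {I : Ideal (MvPolynomial (Fin n) K)} {i : ℕ} {j : ℤ}
    {f : Finset (Fin n) → MvPolynomial (Fin n) K} (hf : f ∈ chains I i j) :
    ∃ g : KoszulIdx n i → idealPiece I (j - (i : ℕ)), extend g = f := by
  refine ⟨fun s => ⟨f s, hf.1 s⟩, ?_⟩
  ext1 s
  unfold extend
  split_ifs with h
  exacts [rfl, (hf.2 s h).symm]

lemma extend_injective {I : Ideal (MvPolynomial (Fin n) K)} {i : ℕ} {k : ℤ} :
    Function.Injective (extend : (KoszulIdx n i → idealPiece I k) → _) := by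
  intro f g h
  ext1 s
  have := congrFun h s.1
  simpa [extend, s.2] using this

lemma diff_eq_zero_of_mem_chains_zero {I : Ideal (MvPolynomial (Fin n) K)} {j : ℤ}
    {f : Finset (Fin n) → MvPolynomial (Fin n) K} (hf : f ∈ chains I 0 j) : diff f = 0 := by
  ext1 s
  rw [diff_apply]
  refine Finset.sum_eq_zero fun t _ => ?_
  rw [hf.2 _ (by simp), mul_zero, smul_zero]

lemma sum_erase_eq {i : ℕ} {s : Finset (Fin n)} (hs : s.card = i)
    (f : KoszulIdx n (i + 1) → MvPolynomial (Fin n) K) :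
    ∑ s' : KoszulIdx n (i + 1), ∑ t ∈ s'.1, koszulSign K t s'.1 •
      (if s'.1.erase t = s then X t * f s' else 0) =
    ∑ t ∈ sᶜ, koszulSign K t s •
      (X t * if h : (insert t s).card = i + 1 then f ⟨insert t s, h⟩ else 0) := by
  have h3 (u : Finset (Fin n)) (g : Fin n → MvPolynomial (Fin n) K) :
      ∑ t ∈ u, g t = ∑ t, if t ∈ u then g t else 0 := by
    rw [Finset.sum_ite_mem, Finset.univ_inter]
  rw [h3 sᶜ, Finset.sum_congr rfl fun s' _ => h3 s'.1 _, Finset.sum_comm]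
  refine Finset.sum_congr rfl fun t _ => ?_
  by_cases ht : t ∈ s
  · rw [if_neg (by simpa using ht)]
    refine Finset.sum_eq_zero fun s' _ => ?_
    rw [if_neg (show ¬ s'.1.erase t = s from fun h => Finset.notMem_erase t s'.1 (h ▸ ht)),
      smul_zero, ite_self]
  · have hc : (insert t s).card = i + 1 := by rw [Finset.card_insert_of_notMem ht, hs]
    rw [if_pos (by simpa using ht), dif_pos hc,
      Finset.sum_eq_single_of_mem ⟨insert t s, hc⟩ (Finset.mem_univ _)]
    · rw [if_pos (Finset.mem_insert_self t s), if_pos (Finset.erase_insert ht)]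
      congr 1
      simp [koszulSign, Finset.filter_insert]
    · intro s' _ hs'
      split_ifs with h4 h5
      · exact (hs' (Subtype.ext ((Finset.insert_erase h4).symm.trans (congrArg (insert t) h5)))).elim
      · exact smul_zero _
      · rfl

lemma extend_koszulDiff (I : Ideal (MvPolynomial (Fin n) K)) (i : ℕ) (j : ℤ)
    (f : KoszulIdx n (i + 1) → idealPiece I (j - (i + 1 : ℕ))) :
    extend (koszulDiff I i j f) = diff (extend f) := by
  ext1 s
  have h1 (s' : KoszulIdx n (i + 1)) (t : Fin n) (ht : t ∈ s'.1) (hs : s.card = i) :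
      ((LinearMap.single (R := K) (φ := fun _ : KoszulIdx n i => idealPiece I (j - (i : ℕ)))
          ⟨s'.1.erase t, by rw [Finset.card_erase_of_mem ht, s'.2]; rfl⟩
        ((LinearEquiv.ofEq _ _ (by rw [show j - ((i : ℕ) + 1 : ℕ) + 1 = j - (i : ℕ) by
          push_cast; ring])).toLinearMap (mulXPiece I t (j - ((i : ℕ) + 1 : ℕ)) (f s')))
        ⟨s, hs⟩ : idealPiece I (j - (i : ℕ))) : MvPolynomial (Fin n) K) =
      if s'.1.erase t = s then X t * (f s' : MvPolynomial (Fin n) K) else 0 := by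
    rw [LinearMap.single_apply, Pi.single_apply]
    simp only [Subtype.mk.injEq, eq_comm (a := s)]
    split_ifs
    exacts [rfl, rfl]
  rw [diff_apply]
  unfold extend
  split_ifs with hs
  · have h2 : ((koszulDiff I i j f ⟨s, hs⟩ : idealPiece I (j - (i : ℕ))) :
        MvPolynomial (Fin n) K) = ∑ s' : KoszulIdx n (i + 1), ∑ t ∈ s'.1, koszulSign K t s'.1 •
          if s'.1.erase t = s then X t * (f s' : MvPolynomial (Fin n) K) else 0 := by
      unfold koszulDiff
      simp only [LinearMap.sum_apply, Finset.sum_apply, Submodule.coe_sum]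
      refine Finset.sum_congr rfl fun s' _ => ?_
      rw [← Finset.sum_attach s'.1]
      refine Finset.sum_congr rfl fun t _ => ?_
      rw [← h1 s' t t.2 hs]
      rfl
    rw [h2]
    exact sum_erase_eq hs _
  · refine (Finset.sum_eq_zero fun t ht => ?_).symm
    rw [dif_neg, mul_zero, smul_zero]
    rw [Finset.card_insert_of_notMem (Finset.mem_compl.1 ht)]
    omega

lemma finrank_sub_finrank_inf_ne_zero_iff {V : Type*} [AddCommGroup V] [Module K V]
    [FiniteDimensional K V] (B Z : Submodule K V) :
    Module.finrank K Z - Module.finrank K ↥(B ⊓ Z) ≠ 0 ↔ ¬ Z ≤ B := by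
  rw [Ne, not_iff_not, Nat.sub_eq_zero_iff_le]
  refine ⟨fun h => ?_, fun h => by rw [inf_eq_right.2 h]⟩
  exact inf_eq_right.1 (Submodule.eq_of_le_of_finrank_le inf_le_right h)

instance finite_idealPiece (I : Ideal (MvPolynomial (Fin n) K)) (k : ℤ) :
    FiniteDimensional K (idealPiece I k) := by
  by_cases h : 0 ≤ k
  · have : Module.Finite K (homogeneousSubmodule (Fin n) K k.toNat) :=
      Module.Finite.iff_fg.2 (homogeneousSubmodule_fg _ _ _)
    rw [idealPiece, if_pos h]
    exact Submodule.finiteDimensional_inf_right _ _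
  · rw [idealPiece, if_neg h]
    infer_instance

lemma mem_koszulCycles_iff (I : Ideal (MvPolynomial (Fin n) K)) (i : ℕ) (j : ℤ)
    (f : KoszulIdx n i → idealPiece I (j - (i : ℕ))) :
    f ∈ koszulCycles I i j ↔ diff (extend f) = 0 := by
  cases i with
  | zero => exact ⟨fun _ => diff_eq_zero_of_mem_chains_zero (extend_mem f), fun _ => trivial⟩
  | succ i =>
    rw [koszulCycles, LinearMap.mem_ker, ← extend_koszulDiff]
    rw [← extend_injective.eq_iff]
    refine Eq.congr rfl ?_
    ext1 s
    simp [extend]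

lemma gradedBetti_ne_zero_iff (I : Ideal (MvPolynomial (Fin n) K)) (i : ℕ) (j : ℤ) :
    gradedBetti I i j ≠ 0 ↔ HasHomology I i j := by
  unfold gradedBetti
  rw [finrank_sub_finrank_inf_ne_zero_iff, SetLike.not_le_iff_exists]
  constructor
  · rintro ⟨f, hf, hf'⟩
    refine ⟨extend f, extend_mem f, (mem_koszulCycles_iff I i j f).1 hf, fun g hg h => hf' ?_⟩
    obtain ⟨g, rfl⟩ := exists_extend_eq hg
    rw [← extend_koszulDiff] at h
    exact ⟨g, extend_injective h⟩
  · rintro ⟨f, hf, hf', h⟩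
    obtain ⟨f, rfl⟩ := exists_extend_eq hf
    refine ⟨f, (mem_koszulCycles_iff I i j f).2 hf', ?_⟩
    rintro ⟨g, rfl⟩
    exact h _ (extend_mem g) (extend_koszulDiff I i j g).symm

/-! ### Operators attached to residues of exponents modulo `d` -/

/-- The part of a polynomial whose exponents `a` satisfy `d ∣ a t + ε`. -/
noncomputable def residue (d : ℕ) (t : Fin n) (ε : ℕ) :
    MvPolynomial (Fin n) K →ₗ[K] MvPolynomial (Fin n) K :=
  coeffPull id Function.injective_id (fun a => d ∣ a t + ε)

/-- Division by `X t` of the part of a polynomial with exponents of `X t` not divisible by `d`. -/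
noncomputable def divVar (d : ℕ) (t : Fin n) :
    MvPolynomial (Fin n) K →ₗ[K] MvPolynomial (Fin n) K :=
  coeffPull (· + Finsupp.single t 1) (add_left_injective _) (fun a => ¬ d ∣ a t + 1)

/-- The exponent of the monomial `∏ t ∈ s, X t ^ (d - 1)`. -/
noncomputable def digits (d : ℕ) (s : Finset (Fin n)) : Fin n →₀ ℕ :=
  Finsupp.equivFunOnFinite.symm fun t => if t ∈ s then d - 1 else 0

lemma digits_apply (d : ℕ) (s : Finset (Fin n)) (t : Fin n) :
    digits d s t = if t ∈ s then d - 1 else 0 := rfl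

lemma degree_digits (d : ℕ) (s : Finset (Fin n)) :
    (digits d s).degree = s.card * (d - 1) := by
  simp [Finsupp.degree_eq_sum, digits_apply]

lemma smul_add_digits_injective (d : ℕ) [NeZero d] (s : Finset (Fin n)) :
    Function.Injective fun a : Fin n →₀ ℕ => d • a + digits d s :=
  fun _ _ h => smul_right_injective _ (NeZero.ne d) (add_right_cancel h)

/-- The operator extracting the coefficient of `∏ t ∈ s, X t ^ (d - 1)` in the expansion of a
polynomial over the subring of polynomials in the `d`-th powers of the variables. -/
noncomputable def contract (d : ℕ) [NeZero d] (s : Finset (Fin n)) :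
    MvPolynomial (Fin n) K →ₗ[K] MvPolynomial (Fin n) K :=
  coeffPull (fun a => d • a + digits d s) (smul_add_digits_injective d s) (fun _ => True)

section coefficients

variable (d : ℕ) (t : Fin n) (p : MvPolynomial (Fin n) K) (a : Fin n →₀ ℕ)

lemma coeff_residue (ε : ℕ) : coeff a (residue d t ε p) = if d ∣ a t + ε then coeff a p else 0 :=
  coeff_coeffPull _ _ _ _ _

lemma coeff_divVar :
    coeff a (divVar d t p) = if d ∣ a t + 1 then 0 else coeff (a + Finsupp.single t 1) p := by
  rw [divVar, coeff_coeffPull, ite_not]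

lemma coeff_contract [NeZero d] (s : Finset (Fin n)) :
    coeff a (contract d s p) = coeff (d • a + digits d s) p := by
  rw [contract, coeff_coeffPull, if_pos trivial]

variable {t}

lemma residue_X_mul_of_ne {u : Fin n} (h : u ≠ t) (ε : ℕ) :
    residue d t ε (X u * p) = X u * residue d t ε p := by
  ext a
  have : (a - Finsupp.single u 1 : Fin n →₀ ℕ) t = a t := by simp [h]
  simp only [coeff_residue, coeff_X_mul_eq_ite, this]
  split_ifs <;> rfl

lemma residue_zero_X_mul : residue d t 0 (X t * p) = X t * residue d t 1 p := by
  ext a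
  simp only [coeff_residue, coeff_X_mul_eq_ite]
  by_cases h : a t = 0
  · simp [h]
  · have : (a - Finsupp.single t 1 : Fin n →₀ ℕ) t + 1 = a t := by simp; omega
    rw [this, add_zero, if_neg h, if_neg h]

lemma residue_X_pow_mul (u : Fin n) (ε : ℕ) :
    residue d t ε (X u ^ d * p) = X u ^ d * residue d t ε p := by
  ext a
  simp only [coeff_residue, coeff_X_pow_mul_eq_ite]
  by_cases h : d ≤ a u
  · rw [if_pos h, if_pos h]
    refine if_congr ?_ rfl rfl
    by_cases hut : u = t
    · subst hut
      rw [Finsupp.tsub_apply, Finsupp.single_eq_same,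
        show a u + ε = a u - d + ε + d by omega, Nat.dvd_add_self_right]
    · simp [hut]
  · simp [h]

lemma divVar_X_mul_of_ne {u : Fin n} (h : u ≠ t) :
    divVar d t (X u * p) = X u * divVar d t p := by
  ext a
  have h1 : (a - Finsupp.single u 1 : Fin n →₀ ℕ) t = a t := by simp [h]
  have h2 : (a + Finsupp.single t 1 : Fin n →₀ ℕ) u = a u := by simp [h]
  simp only [coeff_divVar, coeff_X_mul_eq_ite, h1, h2]
  split_ifs with h3 h4 h4
  any_goals rfl
  congr 1
  ext v
  simp only [Finsupp.tsub_apply, Finsupp.add_apply, Finsupp.single_apply]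
  split_ifs <;> simp_all

lemma divVar_X_mul_self : divVar d t (X t * p) = p - residue d t 1 p := by
  ext a
  simp only [coeff_divVar, coeff_X_mul_eq_ite, coeff_sub, coeff_residue, add_tsub_cancel_right]
  split_ifs <;> simp_all

lemma X_mul_divVar_self : X t * divVar d t p = p - residue d t 0 p := by
  ext a
  simp only [coeff_divVar, coeff_X_mul_eq_ite, coeff_sub, coeff_residue]
  by_cases h : a t = 0
  · simp [h]
  · have h1 : (a - Finsupp.single t 1 : Fin n →₀ ℕ) t + 1 = a t := by simp; omega
    have h2 : a - Finsupp.single t 1 + Finsupp.single t 1 = a :=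
      tsub_add_cancel_of_le (by rw [Finsupp.single_le_iff]; omega)
    rw [h1, h2, if_neg h, add_zero]
    split_ifs <;> simp

lemma divVar_X_pow_mul (u : Fin n) :
    divVar d t (X u ^ d * p) = X u ^ d * divVar d t p := by
  refine mul_left_cancel₀ (X_ne_zero t) ?_
  rw [X_mul_divVar_self, residue_X_pow_mul, mul_left_comm, X_mul_divVar_self, mul_sub]

variable (s : Finset (Fin n))

/-- The semilinear map multiplying the expansion of a polynomial by `∏ t ∈ s, X t ^ (d - 1)`. -/
noncomputable def inflate : MvPolynomial (Fin n) K :=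
  monomial (digits d s) 1 * expand d p

lemma exists_of_coeff_inflate_ne_zero {a : Fin n →₀ ℕ} (h : coeff a (inflate d p s) ≠ 0) :
    ∃ b, a = d • b + digits d s := by
  rw [inflate, coeff_monomial_mul'] at h
  split_ifs at h with h1
  · have h2 (t : Fin n) : d ∣ (a - digits d s) t := by
      by_contra h2
      exact h (by rw [coeff_expand_of_not_dvd p h2, mul_zero])
    choose b hb using h2
    refine ⟨Finsupp.equivFunOnFinite.symm b, ?_⟩
    rw [← tsub_add_cancel_of_le h1]
    congr 1
    ext v
    simpa using hb v
  · exact (h rfl).elim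

variable [NeZero d]

lemma contract_X_mul {s : Finset (Fin n)} (ht : t ∉ s) :
    contract d s (X t * p) = X t * contract d (insert t s) p := by
  ext a
  have hd := NeZero.pos d
  have h1 : (d • a + digits d s) t = d * a t := by simp [digits_apply, ht]
  simp only [coeff_contract, coeff_X_mul_eq_ite, h1]
  by_cases h : a t = 0
  · simp [h]
  · rw [if_neg (by simp [h, NeZero.ne d]), if_neg h]
    congr 1
    ext v
    have h2 : d ≤ d * a t := Nat.le_mul_of_pos_right d (by omega)
    by_cases hv : v = t
    · subst hv
      simp [digits_apply, ht, Nat.mul_sub]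
      omega
    · simp [digits_apply, hv]

lemma contract_X_pow_mul (u : Fin n) :
    contract d s (X u ^ d * p) = X u * contract d s p := by
  ext a
  have hd := NeZero.pos d
  have h1 : d ≤ (d • a + digits d s) u ↔ a u ≠ 0 := by
    have : (d • a + digits d s) u = d * a u + digits d s u := by simp
    rw [this, digits_apply]
    constructor
    · intro h h0
      rw [h0] at h
      split_ifs at h <;> omega
    · intro h
      have := Nat.le_mul_of_pos_right d (Nat.pos_of_ne_zero h)
      omega
  simp only [coeff_contract, coeff_X_mul_eq_ite, coeff_X_pow_mul_eq_ite, h1, ite_not]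
  by_cases h : a u = 0
  · simp [h]
  · rw [if_neg h, if_neg h]
    congr 1
    ext v
    have h2 : d ≤ d * a u := Nat.le_mul_of_pos_right d (by omega)
    by_cases hv : v = u
    · subst hv
      simp [Nat.mul_sub]
      omega
    · simp [hv]

lemma coeff_inflate_smul_add : coeff (d • a + digits d s) (inflate d p s) = coeff a p := by
  rw [inflate, add_comm, coeff_monomial_mul, one_mul, coeff_expand_smul d (NeZero.ne d)]

lemma contract_inflate : contract d s (inflate d p s) = p := by
  ext a
  rw [coeff_contract, coeff_inflate_smul_add]

lemma inflate_contract
    (hp : ∀ a, coeff a p ≠ 0 → ∀ t, d ∣ a t + if t ∈ s then 1 else 0) :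
    inflate d (contract d s p) s = p := by
  ext a
  by_cases h : ∃ b, a = d • b + digits d s
  · obtain ⟨b, rfl⟩ := h
    rw [coeff_inflate_smul_add, coeff_contract]
  · have h1 : coeff a (inflate d (contract d s p) s) = 0 := by
      by_contra h1
      exact h (exists_of_coeff_inflate_ne_zero d _ s h1)
    rw [h1]
    by_contra h2
    have h3 := hp a (Ne.symm h2)
    refine h ?_
    have h4 (t : Fin n) : d ∣ a t - digits d s t ∧ digits d s t ≤ a t := by
      have h5 := h3 t
      rw [digits_apply]
      split_ifs at h5 ⊢ with hts
      · have := Nat.le_of_dvd (by omega) h5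
        have hd := NeZero.pos d
        have h6 : a t - (d - 1) = a t + 1 - d := by omega
        exact ⟨h6 ▸ Nat.dvd_sub h5 dvd_rfl, by omega⟩
      · simpa using h5
    choose b hb using fun t => (h4 t).1
    refine ⟨Finsupp.equivFunOnFinite.symm b, ?_⟩
    ext v
    have := hb v
    have := (h4 v).2
    simp
    omega

lemma inflate_X_mul {s : Finset (Fin n)} (ht : t ∉ s) :
    inflate d (X t * p) s = X t * inflate d p (insert t s) := by
  have hd := NeZero.pos d
  rw [inflate, inflate, map_mul, expand_X, X_pow_eq_monomial, X, ← mul_assoc, ← mul_assoc,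
    monomial_mul, monomial_mul]
  congr 3
  ext v
  by_cases hv : v = t
  · subst hv
    simp [digits_apply, ht]
    omega
  · simp [digits_apply, hv]

end coefficients

/-! ### The operators on Koszul chains -/

lemma mem_chains_iff {I : Ideal (MvPolynomial (Fin n) K)} {i : ℕ} {j : ℤ}
    {f : Finset (Fin n) → MvPolynomial (Fin n) K} :
    f ∈ chains I i j ↔
      (∀ s, s.card = i → f s ∈ idealPiece I (j - i)) ∧ ∀ s, s.card ≠ i → f s = 0 := by
  refine ⟨fun h => ⟨fun s _ => h.1 s, h.2⟩, fun h => ⟨fun s => ?_, h.2⟩⟩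
  by_cases hs : s.card = i
  · exact h.1 s hs
  · rw [h.2 s hs]
    exact zero_mem _

section pieces

variable {d : ℕ} {I : Ideal (MvPolynomial (Fin n) K)} {p : MvPolynomial (Fin n) K}

lemma residue_mem_idealPiece {k : ℤ} (t : Fin n) (ε : ℕ)
    (hp : p ∈ idealPiece (I.map (expand d)) k) :
    residue d t ε p ∈ idealPiece (I.map (expand d)) k := by
  rw [mem_idealPiece_iff] at hp ⊢
  refine ⟨map_mem_of_semilinear _ (expand d) (fun m hm => Ideal.mem_map_of_mem _ hm)
    (fun u r => by rw [expand_X, residue_X_pow_mul]) hp.1, fun a ha => hp.2 a fun h => ha ?_⟩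
  rw [coeff_residue, h, ite_self]

lemma divVar_mem_idealPiece {k : ℤ} (t : Fin n)
    (hp : p ∈ idealPiece (I.map (expand d)) k) :
    divVar d t p ∈ idealPiece (I.map (expand d)) (k - 1) := by
  rw [mem_idealPiece_iff] at hp ⊢
  refine ⟨map_mem_of_semilinear _ (expand d) (fun m hm => Ideal.mem_map_of_mem _ hm)
    (fun u r => by rw [expand_X, divVar_X_pow_mul]) hp.1, fun a ha => ?_⟩
  have := hp.2 (a + Finsupp.single t 1) fun h => ha (by rw [coeff_divVar, h, ite_self])
  rw [map_add, Finsupp.degree_single] at this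
  push_cast at this
  omega

variable [NeZero d] {i : ℕ} {j : ℤ} {s : Finset (Fin n)}

lemma degree_smul_add_digits (hs : s.card = i) (a : Fin n →₀ ℕ) :
    ((d • a + digits d s).degree : ℤ) = d * j - i ↔ (a.degree : ℤ) = j - i := by
  have hd := NeZero.pos d
  have hd' : (d : ℤ) ≠ 0 := by exact_mod_cast hd.ne'
  rw [map_add, degree_digits, map_nsmul, hs, smul_eq_mul]
  push_cast [Nat.cast_sub (show 1 ≤ d from hd)]
  constructor
  · intro h
    exact mul_left_cancel₀ hd' (by linarith)
  · intro h
    rw [h]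
    ring

lemma contract_mem_idealPiece (hs : s.card = i)
    (hp : p ∈ idealPiece (I.map (expand d)) (d * j - i)) :
    contract d s p ∈ idealPiece I (j - i) := by
  rw [mem_idealPiece_iff] at hp ⊢
  refine ⟨map_mem_of_semilinear _ (AlgHom.id K _) (fun m hm => hm)
    (fun u r => contract_X_pow_mul d r s u) hp.1, fun a ha => ?_⟩
  rw [coeff_contract] at ha
  exact (degree_smul_add_digits hs a).1 (hp.2 _ ha)

lemma inflate_mem_idealPiece (hs : s.card = i) (hp : p ∈ idealPiece I (j - i)) :
    inflate d p s ∈ idealPiece (I.map (expand d)) (d * j - i) := by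
  rw [mem_idealPiece_iff] at hp ⊢
  refine ⟨Ideal.mul_mem_left _ _ (Ideal.mem_map_of_mem _ hp.1), fun a ha => ?_⟩
  obtain ⟨b, rfl⟩ := exists_of_coeff_inflate_ne_zero d p s ha
  rw [coeff_inflate_smul_add] at ha
  exact (degree_smul_add_digits hs b).2 (hp.2 _ ha)

end pieces

section chains

variable (d : ℕ) (f : Finset (Fin n) → MvPolynomial (Fin n) K)

/-- The part of a Koszul chain of residue `0` modulo `d` in the multidegree of `t`. -/
noncomputable def residueChain (t : Fin n) (s : Finset (Fin n)) : MvPolynomial (Fin n) K :=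
  residue d t (if t ∈ s then 1 else 0) (f s)

/-- A homotopy between the identity and `residueChain`. -/
noncomputable def homotopy (t : Fin n) (s : Finset (Fin n)) : MvPolynomial (Fin n) K :=
  if t ∈ s then koszulSign K t s • divVar d t (f (s.erase t)) else 0

lemma diff_residueChain (t : Fin n) :
    diff (residueChain d f t) = residueChain d (diff f) t := by
  ext1 s
  simp only [diff_apply, residueChain, map_sum, map_smul]
  refine Finset.sum_congr rfl fun u hu => ?_
  congr 1
  by_cases hut : u = t
  · subst hut
    rw [if_pos (Finset.mem_insert_self _ _), if_neg (Finset.mem_compl.1 hu), residue_zero_X_mul]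
  · rw [residue_X_mul_of_ne d _ hut]
    simp only [Finset.mem_insert, Ne.symm hut, false_or]

lemma koszulSign_mul_self (t : Fin n) (s : Finset (Fin n)) :
    koszulSign K t s * koszulSign K t s = 1 := by
  rw [koszulSign, ← mul_pow]
  simp

lemma koszulSign_insert_self (t : Fin n) (s : Finset (Fin n)) :
    koszulSign K t (insert t s) = koszulSign K t s := by
  simp [koszulSign, Finset.filter_insert]

lemma koszulSign_insert {t u : Fin n} {s : Finset (Fin n)} (hu : u ∉ s) :
    koszulSign K t (insert u s) = if u < t then - koszulSign K t s else koszulSign K t s := by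
  unfold koszulSign
  rw [Finset.filter_insert]
  split_ifs with h
  · rw [Finset.card_insert_of_notMem (by simp [hu]), pow_succ]
    ring
  · rfl

lemma koszulSign_mul_insert {t u : Fin n} {s : Finset (Fin n)} (ht : t ∉ s) (hu : u ∉ s)
    (htu : u ≠ t) :
    koszulSign K u (insert t s) * koszulSign K t (insert u s) =
      - (koszulSign K t s * koszulSign K u s) := by
  rw [koszulSign_insert ht, koszulSign_insert hu]
  rcases lt_or_gt_of_ne htu with h | h
  · rw [if_neg h.not_gt, if_pos h]
    ring
  · rw [if_pos h, if_neg h.not_gt]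
    ring

lemma diff_homotopy_add (t : Fin n) :
    diff (homotopy d f t) + homotopy d (diff f) t = f - residueChain d f t := by
  ext1 s
  rw [Pi.add_apply, Pi.sub_apply]
  by_cases ht : t ∈ s
  · obtain ⟨s, hts, rfl⟩ : ∃ s', t ∉ s' ∧ insert t s' = s :=
      ⟨s.erase t, Finset.notMem_erase t s, Finset.insert_erase ht⟩
    have hc : sᶜ = insert t (insert t s)ᶜ := by
      ext u
      by_cases hu : u = t <;> simp [hu, hts]
    rw [homotopy, if_pos ht, residueChain, if_pos ht, Finset.erase_insert hts, diff_apply,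
      diff_apply, hc, Finset.sum_insert (by simp), map_add, map_smul, divVar_X_mul_self,
      smul_add, smul_smul, koszulSign_insert_self, koszulSign_mul_self, one_smul, map_sum,
      Finset.smul_sum, add_left_comm, ← Finset.sum_add_distrib, Finset.sum_eq_zero, add_zero]
    intro u hu
    have hu' : u ≠ t ∧ u ∉ s := by simpa using hu
    have h1 : (insert u (insert t s)).erase t = insert u s := by
      rw [Finset.insert_comm, Finset.erase_insert]
      simp [hts, Ne.symm hu'.1]
    rw [homotopy, if_pos (by simp), h1, Finset.insert_comm, koszulSign_insert_self, map_smul,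
      divVar_X_mul_of_ne _ _ hu'.1, mul_smul_comm, smul_smul, smul_smul,
      koszulSign_mul_insert hts hu'.2 hu'.1, neg_smul, neg_add_cancel]
  · rw [homotopy, if_neg ht, add_zero, residueChain, if_neg ht, diff_apply,
      Finset.sum_eq_single_of_mem t (by simpa using ht), homotopy,
      if_pos (Finset.mem_insert_self t s), Finset.erase_insert ht, koszulSign_insert_self,
      mul_smul_comm, smul_smul, koszulSign_mul_self, one_smul, X_mul_divVar_self]
    intro u _ hu
    rw [homotopy, if_neg (by simp [ht, Ne.symm hu]), mul_zero, smul_zero]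

variable {d f} {I : Ideal (MvPolynomial (Fin n) K)} {i : ℕ} {j : ℤ}

lemma residueChain_mem (t : Fin n) (hf : f ∈ chains (I.map (expand d)) i j) :
    residueChain d f t ∈ chains (I.map (expand d)) i j :=
  ⟨fun s => residue_mem_idealPiece _ _ (hf.1 s),
    fun s hs => by rw [residueChain, hf.2 s hs, map_zero]⟩

lemma homotopy_mem (t : Fin n) (hf : f ∈ chains (I.map (expand d)) i j) :
    homotopy d f t ∈ chains (I.map (expand d)) (i + 1) j := by
  rw [mem_chains_iff]
  refine ⟨fun s hs => ?_, fun s hs => ?_⟩ <;> unfold homotopy <;> split_ifs with ht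
  · refine Submodule.smul_mem _ _ ?_
    rw [show j - ((i + 1 : ℕ) : ℤ) = j - i - 1 by push_cast; ring]
    exact divVar_mem_idealPiece t (hf.1 _)
  · exact zero_mem _
  · rw [hf.2, map_zero, smul_zero]
    have := Finset.card_erase_add_one ht
    omega
  · rfl

/-- A homology class of the extended ideal is represented by a cycle all of whose multidegrees are
divisible by `d`. -/
lemma exists_cycle_dvd (h : HasHomology (I.map (expand d)) i j) :
    ∃ f ∈ chains (I.map (expand d)) i j, diff f = 0 ∧
      (∀ g ∈ chains (I.map (expand d)) (i + 1) j, diff g ≠ f) ∧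
      ∀ s a, coeff a (f s) ≠ 0 → ∀ t, d ∣ a t + if t ∈ s then 1 else 0 := by
  suffices H : ∀ T : Finset (Fin n), ∃ f ∈ chains (I.map (expand d)) i j, diff f = 0 ∧
      (∀ g ∈ chains (I.map (expand d)) (i + 1) j, diff g ≠ f) ∧
      ∀ s a, coeff a (f s) ≠ 0 → ∀ t ∈ T, d ∣ a t + if t ∈ s then 1 else 0 by
    simpa using H Finset.univ
  intro T
  induction T using Finset.induction_on with
  | empty =>
    obtain ⟨f, hf, hf0, hfg⟩ := h
    exact ⟨f, hf, hf0, hfg, by simp⟩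
  | insert t T _ ih =>
    obtain ⟨f, hf, hf0, hfg, hfT⟩ := ih
    have h0 (t : Fin n) : residueChain d (0 : Finset (Fin n) → MvPolynomial (Fin n) K) t = 0 := by
      ext1 s
      exact map_zero _
    have h0' : homotopy d (0 : Finset (Fin n) → MvPolynomial (Fin n) K) t = 0 := by
      ext1 s
      simp [homotopy]
    refine ⟨residueChain d f t, residueChain_mem t hf, ?_, fun g hg hgf => ?_,
      fun s a ha u hu => ?_⟩
    · rw [diff_residueChain, hf0, h0]
    · refine hfg (homotopy d f t + g) (add_mem (homotopy_mem t hf) hg) ?_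
      have := diff_homotopy_add d f t
      rw [hf0, h0', add_zero] at this
      rw [map_add, this, hgf, sub_add_cancel]
    · rw [residueChain, coeff_residue] at ha
      split_ifs at ha with h1 h2 h2
      all_goals first | exact (ha rfl).elim | skip
      all_goals
        rcases Finset.mem_insert.1 hu with rfl | hu
        · simpa [h1] using h2
        · exact hfT s a ha u hu

lemma inflate_zero (s : Finset (Fin n)) : inflate d (0 : MvPolynomial (Fin n) K) s = 0 := by
  rw [inflate, map_zero, mul_zero]

variable [NeZero d]

lemma diff_inflate (f : Finset (Fin n) → MvPolynomial (Fin n) K) :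
    (diff fun s => inflate d (f s) s) = fun s => inflate d (diff f s) s := by
  ext1 s
  rw [diff_apply, diff_apply, inflate, map_sum, Finset.mul_sum]
  refine Finset.sum_congr rfl fun t ht => ?_
  rw [← inflate_X_mul d _ (Finset.mem_compl.1 ht), map_smul, mul_smul_comm, inflate]

lemma diff_contract (f : Finset (Fin n) → MvPolynomial (Fin n) K) :
    (diff fun s => contract d s (f s)) = fun s => contract d s (diff f s) := by
  ext1 s
  rw [diff_apply, diff_apply, map_sum]
  refine Finset.sum_congr rfl fun t ht => ?_
  rw [map_smul, contract_X_mul d _ (Finset.mem_compl.1 ht)]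

lemma inflate_mem_chains (hf : f ∈ chains I i j) :
    (fun s => inflate d (f s) s) ∈ chains (I.map (expand d)) i (d * j) :=
  mem_chains_iff.2 ⟨fun s hs => inflate_mem_idealPiece hs (hf.1 s),
    fun s hs => by rw [hf.2 s hs, inflate_zero]⟩

lemma contract_mem_chains (hf : f ∈ chains (I.map (expand d)) i (d * j)) :
    (fun s => contract d s (f s)) ∈ chains I i j :=
  mem_chains_iff.2 ⟨fun s hs => contract_mem_idealPiece hs (hf.1 s),
    fun s hs => by rw [hf.2 s hs, map_zero]⟩

lemma HasHomology.map_expand (h : HasHomology I i j) :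
    HasHomology (I.map (expand d)) i (d * j) := by
  obtain ⟨f, hf, hf0, hfg⟩ := h
  refine ⟨_, inflate_mem_chains hf, ?_, fun g hg hgf => hfg _ (contract_mem_chains hg) ?_⟩
  · rw [diff_inflate, hf0]
    ext1 s
    exact inflate_zero s
  · rw [diff_contract, hgf]
    ext1 s
    exact contract_inflate d (f s) s

lemma HasHomology.of_map_expand (h : HasHomology (I.map (expand d)) i j) :
    ∃ k, j = d * k ∧ HasHomology I i k := by
  obtain ⟨f, hf, hf0, hfg, hfd⟩ := exists_cycle_dvd h
  obtain ⟨s, hs⟩ : ∃ s, f s ≠ 0 := by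
    by_contra! h0
    exact hfg 0 (zero_mem _) (by rw [map_zero]; exact (funext h0).symm)
  obtain ⟨a, ha⟩ := exists_coeff_ne_zero hs
  have hsi : s.card = i := by
    by_contra hsi
    exact hs (hf.2 s hsi)
  have hdeg := (mem_idealPiece_iff.1 (hf.1 s)).2 a ha
  have hdvd : d ∣ a.degree + s.card := by
    have := Finset.dvd_sum fun t (_ : t ∈ Finset.univ) => hfd s a ha t
    rwa [Finset.sum_add_distrib, ← Finsupp.degree_eq_sum, Finset.sum_boole, Finset.filter_univ_mem,
      Nat.cast_id] at this
  obtain ⟨k, hk⟩ := hdvd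
  obtain rfl : j = d * (k : ℤ) := by
    have : (a.degree : ℤ) + s.card = d * k := by exact_mod_cast hk
    rw [hsi] at this
    linarith
  refine ⟨k, rfl, _, contract_mem_chains hf, ?_, fun g hg hgf =>
    hfg _ (inflate_mem_chains hg) ?_⟩
  · rw [diff_contract, hf0]
    ext1 s
    exact map_zero _
  · rw [diff_inflate, hgf]
    ext1 s
    exact inflate_contract d (f s) s (hfd s)

end chains

lemma sSup_image_mul {d : ℕ} (hd : 0 < d) (S : Set ℤ) :
    sSup ((fun j => (d : ℤ) * j) '' S) = d * sSup S := by
  have hd' : (0 : ℤ) < d := by exact_mod_cast hd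
  rcases S.eq_empty_or_nonempty with rfl | hne
  · simp [Int.csSup_empty]
  by_cases hb : BddAbove S
  · refine IsGreatest.csSup_eq ⟨⟨_, Int.csSup_mem hne hb, rfl⟩, ?_⟩
    rintro _ ⟨j, hj, rfl⟩
    exact mul_le_mul_of_nonneg_left (le_csSup hb hj) hd'.le
  · rw [Int.csSup_of_not_bddAbove hb, Int.csSup_of_not_bddAbove, mul_zero]
    rintro ⟨b, hb'⟩
    refine hb ⟨max b 0, fun j hj => ?_⟩
    have h1 : (d : ℤ) * j ≤ b := hb' ⟨j, hj, rfl⟩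
    by_contra! h2
    have h3 := max_lt_iff.1 h2
    nlinarith

end PowerMap

/-- Let `α : R → R` be the `K`-algebra map of `R = K[x_1,…,x_n]` with `α(x_i) = x_i^d`,
`d > 0`, and `I' = α(I)R` for a homogeneous ideal `I`.  For `0 ≤ i ≤ projdim(I)`, the
maximal shifts `t_i(I) = max{ j : β_{i,j}(I) ≠ 0 }` satisfy `t_i(I') = d·t_i(I)`. -/
theorem maxShift_power_map {n : ℕ} (d : ℕ) (hd : 0 < d)
    (I : Ideal (MvPolynomial (Fin n) K)) (hI : IsHomogeneousIdeal I) :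
    ∀ i : ℕ, i ≤ projdim I →
      maxShift (Ideal.map
        (aeval (fun i => (X i : MvPolynomial (Fin n) K) ^ d) :
          MvPolynomial (Fin n) K →ₐ[K] MvPolynomial (Fin n) K) I) i =
        d * maxShift I i := by
  intro i _
  have : NeZero d := ⟨hd.ne'⟩
  change maxShift (I.map (expand d)) i = _
  unfold maxShift
  rw [← PowerMap.sSup_image_mul hd]
  congr 1
  ext j
  simp only [Set.mem_ofPred_eq, Set.mem_image, PowerMap.gradedBetti_ne_zero_iff]
  constructor
  · intro h
    obtain ⟨k, rfl, hk⟩ := h.of_map_expand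
    exact ⟨k, hk, rfl⟩
  · rintro ⟨k, hk, rfl⟩
    exact hk.map_expand
end
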